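/- Let I be a Z^v-graded Cartwright-Sturmfels ideal of S. Then the Castelnuovo-Mumford regularity of I satisfies reg(I) ≤ v. -/

import Mathlib

open MvPolynomial

noncomputable section

namespace CSPaper

/-- The set of variables of the standard `ℤ^v`-graded polynomial ring `S`:
the variable `x_{i j}` of the paper (with `1 ≤ i ≤ v`, `1 ≤ j ≤ n_i`) corresponds to
`⟨i-1, j-1⟩ : MVar v n` where `n (i-1) = n_i - 1`; thus row `i` has `n i + 1 > 0`
variables and the first variable `x_{i 1}` of row `i` corresponds to `⟨i, 0⟩`. -/
abbrev MVar (v : ℕ) (n : Fin v → ℕ) : Type := Σ i : Fin v, Fin (n i + 1)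

/-- The weight function giving the standard `ℤ^v`-grading: `deg (x_{i j}) = e_i ∈ ℤ^v`. -/
def wt (v : ℕ) (n : Fin v → ℕ) : MVar v n → (Fin v → ℕ) := fun p => Pi.single p.1 1

variable {K : Type} [Field K] {v : ℕ} {n : Fin v → ℕ}

/-- An ideal of `S` is `ℤ^v`-graded (multigraded) iff it contains every multihomogeneous
component of each of its elements. -/
def IsMultigraded (I : Ideal (MvPolynomial (MVar v n) K)) : Prop :=
  ∀ f ∈ I, ∀ a : Fin v → ℕ, weightedHomogeneousComponent (wt v n) a f ∈ I

/-- The value of the `ℤ^v`-graded Hilbert function of the ideal `I` at `a ∈ ℕ^v`: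
`dim_K I_a`. -/
def hilb (I : Ideal (MvPolynomial (MVar v n) K)) (a : Fin v → ℕ) : ℕ :=
  Module.finrank K
    ((Submodule.restrictScalars K I ⊓ weightedHomogeneousSubmodule K (wt v n) a :
      Submodule K (MvPolynomial (MVar v n) K)))

/-- Two ideals have the same `ℤ^v`-graded Hilbert series. -/
def sameHS (I J : Ideal (MvPolynomial (MVar v n) K)) : Prop :=
  ∀ a : Fin v → ℕ, hilb I a = hilb J a

/-- The `ℤ^v`-graded `K`-algebra endomorphism of `S` determined by a `v`-tuple of square
matrices: `x_{i j} ↦ ∑_k (g i)_{k j} x_{i k}`.  For invertible `g i` these are exactly the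
elements of `G = GL_{n_1}(K) × ⋯ × GL_{n_v}(K)` acting on `S`. -/
def gAct (g : ∀ i : Fin v, Matrix (Fin (n i + 1)) (Fin (n i + 1)) K) :
    MvPolynomial (MVar v n) K →ₐ[K] MvPolynomial (MVar v n) K :=
  aeval fun p : MVar v n => ∑ k : Fin (n p.1 + 1), C (g p.1 k p.2) * X ⟨p.1, k⟩

/-- A property `P` of `v`-tuples of matrices holds generically (i.e. for a general
`g ∈ GL_{n_1}(K) × ⋯ × GL_{n_v}(K)`) if there is a nonzero polynomial `h` in the matrix
entries such that `P g` holds for every invertible `g` with `h(g) ≠ 0`. -/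
def Generically
    (P : (∀ i : Fin v, Matrix (Fin (n i + 1)) (Fin (n i + 1)) K) → Prop) : Prop :=
  ∃ h : MvPolynomial (Σ i : Fin v, Fin (n i + 1) × Fin (n i + 1)) K, h ≠ 0 ∧
    ∀ g : ∀ i : Fin v, Matrix (Fin (n i + 1)) (Fin (n i + 1)) K,
      (∀ i, IsUnit (g i).det) →
      eval (fun q : Σ i : Fin v, Fin (n i + 1) × Fin (n i + 1) => g q.1 q.2.1 q.2.2) h ≠ 0 →
      P g

/-- The leading exponent (exponent of the leading monomial) of a polynomial with respect to
a term order `τ` (a `MonomialOrder`); by convention `leadExp τ 0 = 0`. -/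
def leadExp (τ : MonomialOrder (MVar v n)) (f : MvPolynomial (MVar v n) K) :
    MVar v n →₀ ℕ :=
  τ.toSyn.symm (f.support.sup τ.toSyn)

/-- The initial ideal `in_τ(I)`: the monomial ideal generated by the leading monomials of the
nonzero elements of `I`. -/
def inIdeal (τ : MonomialOrder (MVar v n)) (I : Ideal (MvPolynomial (MVar v n) K)) :
    Ideal (MvPolynomial (MVar v n) K) :=
  Ideal.span {m | ∃ f ∈ I, f ≠ 0 ∧ m = monomial (leadExp τ f) (1 : K)}

/-- `G` is a Gröbner basis of `I` with respect to the term order `τ`. -/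
def IsGroebnerBasis (τ : MonomialOrder (MVar v n)) (G : Set (MvPolynomial (MVar v n) K))
    (I : Ideal (MvPolynomial (MVar v n) K)) : Prop :=
  G ⊆ (I : Set (MvPolynomial (MVar v n) K)) ∧
    Ideal.span ((fun f => monomial (leadExp τ f) (1 : K)) '' {f ∈ G | f ≠ 0}) = inIdeal τ I

/-- `J = gin_τ(I)`, the `ℤ^v`-graded generic initial ideal: for a general
`g ∈ GL_{n_1}(K) × ⋯ × GL_{n_v}(K)` one has `in_τ(g(I)) = J`. -/
def IsGin (τ : MonomialOrder (MVar v n)) (I J : Ideal (MvPolynomial (MVar v n) K)) : Prop :=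
  Generically fun g => inIdeal τ (Ideal.map (gAct g) I) = J

/-- A term order such that `x_{i j} > x_{i k}` whenever `j < k`. -/
def RespectsVarOrder (τ : MonomialOrder (MVar v n)) : Prop :=
  ∀ (i : Fin v) (j k : Fin (n i + 1)), j < k →
    τ.toSyn (Finsupp.single (⟨i, k⟩ : MVar v n) 1) <
      τ.toSyn (Finsupp.single (⟨i, j⟩ : MVar v n) 1)

/-- An ideal is Borel fixed if it is fixed by every element of the Borel subgroup
`B = B_{n_1}(K) × ⋯ × B_{n_v}(K)` of upper triangular invertible matrices (upper triangular
with respect to the order `x_{i 1} > x_{i 2} > ⋯` of the variables in each row). -/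
def BorelFixed (I : Ideal (MvPolynomial (MVar v n) K)) : Prop :=
  ∀ g : ∀ i : Fin v, Matrix (Fin (n i + 1)) (Fin (n i + 1)) K,
    (∀ i, IsUnit (g i).det) →
    (∀ (i : Fin v) (k j : Fin (n i + 1)), j < k → g i k j = 0) →
    Ideal.map (gAct g) I = I

/-- A Cartwright-Sturmfels ideal: a `ℤ^v`-graded ideal with the same `ℤ^v`-graded Hilbert
series as some radical Borel fixed ideal. -/
def IsCS (I : Ideal (MvPolynomial (MVar v n) K)) : Prop :=
  IsMultigraded I ∧ ∃ J : Ideal (MvPolynomial (MVar v n) K),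
    J.IsRadical ∧ BorelFixed J ∧ sameHS I J

/-- The exponent of the monomial `x_{1 1}^{a 1} ⋯ x_{v 1}^{a v}` of
`T = K[x_{1 1}, …, x_{v 1}] ⊆ S`. -/
def Tmono (v : ℕ) (n : Fin v → ℕ) (a : Fin v → ℕ) : MVar v n →₀ ℕ :=
  ∑ i : Fin v, Finsupp.single (⟨i, 0⟩ : MVar v n) (a i)

/-- A `ℤ^v`-graded ideal of `S` extended from `T`, i.e. generated by monomials in the
variables `x_{1 1}, …, x_{v 1}`. -/
def ExtendedFromT (J : Ideal (MvPolynomial (MVar v n) K)) : Prop :=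
  ∃ A : Set (Fin v → ℕ),
    J = Ideal.span ((fun a => monomial (Tmono v n a) (1 : K)) '' A)

/-- A Cartwright-Sturmfels* ideal: a `ℤ^v`-graded ideal with the same `ℤ^v`-graded Hilbert
series as some ideal extended from `T`. -/
def IsCSstar (J : Ideal (MvPolynomial (MVar v n) K)) : Prop :=
  IsMultigraded J ∧ ∃ C : Ideal (MvPolynomial (MVar v n) K), ExtendedFromT C ∧ sameHS J C

/-- A monomial ideal. -/
def IsMonomialIdeal (I : Ideal (MvPolynomial (MVar v n) K)) : Prop :=
  ∃ A : Set (MVar v n →₀ ℕ), I = Ideal.span ((fun s => monomial s (1 : K)) '' A)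

/-- A squarefree monomial ideal. -/
def IsSqfreeMonomialIdeal (I : Ideal (MvPolynomial (MVar v n) K)) : Prop :=
  ∃ A : Set (MVar v n →₀ ℕ), (∀ s ∈ A, ∀ x, s x ≤ 1) ∧
    I = Ideal.span ((fun s => monomial s (1 : K)) '' A)

/-- `J` is the Alexander dual of the squarefree monomial ideal `I`: `J` is generated by the
products `∏_{x ∈ P} x` as `P` ranges over the minimal primes of `I`. -/
def IsAlexanderDual (I J : Ideal (MvPolynomial (MVar v n) K)) : Prop :=
  J = Ideal.span {m | ∃ F : Finset (MVar v n),
    Ideal.span ((fun x => (X x : MvPolynomial (MVar v n) K)) '' ↑F) ∈ I.minimalPrimes ∧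
    m = ∏ x ∈ F, X x}

/-- The sequence `x_{i j} - λ_{i j} x_{i 1}`, `1 ≤ i ≤ v`, `2 ≤ j ≤ n_i`, as a list. -/
def LamList (lam : MVar v n → K) : List (MvPolynomial (MVar v n) K) :=
  (List.finRange v).flatMap fun i =>
    ((List.finRange (n i + 1)).drop 1).map fun j =>
      X (⟨i, j⟩ : MVar v n) - C (lam ⟨i, j⟩) * X (⟨i, 0⟩ : MVar v n)

/-- A property of the scalars `λ = (λ_{i j})` holds for general `λ ∈ K^N` if there is a
nonzero polynomial `h` in the `λ_{i j}` such that the property holds whenever `h(λ) ≠ 0`. -/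
def GenericallyLam {v : ℕ} {n : Fin v → ℕ} (K : Type) [Field K]
    (P : (MVar v n → K) → Prop) : Prop :=
  ∃ h : MvPolynomial (MVar v n) K, h ≠ 0 ∧
    ∀ lam : MVar v n → K, eval lam h ≠ 0 → P lam

variable {K : Type} [Field K] {v : ℕ} {n : Fin v → ℕ}

/-- A graded free resolution of an ideal `I` of a polynomial ring graded by an additive
monoid `M` via a weight function `w` on the variables:
`⋯ → F_2 → F_1 → F_0 → I → 0`, where `F_p` is the free module with (finite) basis `ι p`,
the basis element `i : ι p` having degree `deg p i ∈ M`, all maps are graded of degree `0`,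
and the complex is exact. -/
structure GradedFreeResolution (σ : Type) (K : Type) [Field K] (M : Type) [AddCommMonoid M]
    (w : σ → M) (I : Ideal (MvPolynomial σ K)) where
  ι : ℕ → Type
  finite : ∀ p, Finite (ι p)
  deg : ∀ p, ι p → M
  aug : (ι 0 →₀ MvPolynomial σ K) →ₗ[MvPolynomial σ K] MvPolynomial σ K
  d : ∀ p, (ι (p + 1) →₀ MvPolynomial σ K) →ₗ[MvPolynomial σ K] (ι p →₀ MvPolynomial σ K)
  aug_graded : ∀ i : ι 0, (aug (Finsupp.single i 1)).IsWeightedHomogeneous w (deg 0 i)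
  d_graded : ∀ (p : ℕ) (i : ι (p + 1)) (j : ι p),
    (d p (Finsupp.single i 1)) j = 0 ∨
      ∃ b, ((d p (Finsupp.single i 1)) j).IsWeightedHomogeneous w b ∧
        b + deg p j = deg (p + 1) i
  range_aug : LinearMap.range aug = (I : Submodule (MvPolynomial σ K) (MvPolynomial σ K))
  exact_zero : LinearMap.ker aug = LinearMap.range (d 0)
  exact : ∀ p, LinearMap.ker (d p) = LinearMap.range (d (p + 1))

/-- A graded free resolution is minimal if all entries of the matrices of the differentials
between free modules lie in the irrelevant maximal ideal, i.e. have zero constant term. -/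
def GradedFreeResolution.Minimal {σ M : Type} [AddCommMonoid M] {w : σ → M}
    {I : Ideal (MvPolynomial σ K)} (F : GradedFreeResolution σ K M w I) : Prop :=
  ∀ (p : ℕ) (i : F.ι (p + 1)) (j : F.ι p),
    MvPolynomial.constantCoeff ((F.d p (Finsupp.single i 1)) j) = 0

/-- The graded Betti number `β_{p,a}` read off from a (minimal) graded free resolution:
the number of basis elements of `F_p` of degree `a`. -/
def GradedFreeResolution.betti {σ M : Type} [AddCommMonoid M] {w : σ → M}
    {I : Ideal (MvPolynomial σ K)} (F : GradedFreeResolution σ K M w I) (p : ℕ) (a : M) :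
    ℕ :=
  Nat.card {i : F.ι p // F.deg p i = a}

/-- The set of `t × t` minors of the matrix `A`. -/
def minorsSet {R : Type} [CommRing R] (t : ℕ) {m N : ℕ} (A : Matrix (Fin m) (Fin N) R) :
    Set R :=
  {d | ∃ (r : Fin t → Fin m) (c : Fin t → Fin N),
    Function.Injective r ∧ Function.Injective c ∧ d = (A.submatrix r c).det}

/-- `I_t(A)`, the ideal generated by the `t × t` minors of `A`. -/
def minorsIdeal {R : Type} [CommRing R] (t : ℕ) {m N : ℕ}
    (A : Matrix (Fin m) (Fin N) R) : Ideal R :=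
  Ideal.span (minorsSet t A)

/-- `A` is column-graded: `N ≤ v` and each entry of the `j`-th column is either `0` or
multihomogeneous of degree `e_j ∈ ℤ^v`. -/
def ColumnGraded {m N : ℕ} (A : Matrix (Fin m) (Fin N) (MvPolynomial (MVar v n) K)) :
    Prop :=
  ∃ h : N ≤ v, ∀ i j, A i j = 0 ∨
    (A i j).IsWeightedHomogeneous (wt v n) (Pi.single (Fin.castLE h j) 1)

/-- `A` is row-graded: `m ≤ v` and each entry of the `i`-th row is either `0` or
multihomogeneous of degree `e_i ∈ ℤ^v`. -/
def RowGraded {m N : ℕ} (A : Matrix (Fin m) (Fin N) (MvPolynomial (MVar v n) K)) : Prop :=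
  ∃ h : m ≤ v, ∀ i j, A i j = 0 ∨
    (A i j).IsWeightedHomogeneous (wt v n) (Pi.single (Fin.castLE h i) 1)

/-- The exponent of the polarization of the monomial `x_{1 1}^{a 1} ⋯ x_{v 1}^{a v}` of `T`:
the squarefree monomial `∏_i x_{i 1} x_{i 2} ⋯ x_{i (a i)}`. -/
def polExp (v : ℕ) (n : Fin v → ℕ) (a : Fin v → ℕ) : MVar v n →₀ ℕ :=
  ∑ i : Fin v, ∑ j ∈ Finset.univ.filter (fun j : Fin (n i + 1) => (j : ℕ) < a i),
    Finsupp.single (⟨i, j⟩ : MVar v n) 1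

/-- `P = pol(C)`, the polarization of an ideal `C` extended from `T`
(the exponents of the generators of `C` must fit inside `S`). -/
def IsPolarizationOfT (C P : Ideal (MvPolynomial (MVar v n) K)) : Prop :=
  ∃ A : Set (Fin v → ℕ), (∀ a ∈ A, ∀ i, a i ≤ n i + 1) ∧
    C = Ideal.span ((fun a => monomial (Tmono v n a) (1 : K)) '' A) ∧
    P = Ideal.span ((fun a => monomial (polExp v n a) (1 : K)) '' A)

/-- `ψ` is an identification of the quotient of `S` by the `ℤ^v`-graded ideal `Q` with a
standard `ℤ^v`-graded polynomial ring, compatible with the gradings. -/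
def IsGradedStructureIso {n₂ : Fin v → ℕ} (Q : Ideal (MvPolynomial (MVar v n) K))
    (ψ : (MvPolynomial (MVar v n) K ⧸ Q) ≃ₐ[K] MvPolynomial (MVar v n₂) K) : Prop :=
  ∀ (f : MvPolynomial (MVar v n) K) (a : Fin v → ℕ),
    f.IsWeightedHomogeneous (wt v n) a →
      (ψ (Ideal.Quotient.mk Q f)).IsWeightedHomogeneous (wt v n₂) a

end CSPaper

open CSPaper

namespace CSReg

section Fock

variable {V : Type} [Fintype V] [DecidableEq V] {R : Type} [CommRing R]
  {M : Type} [AddCommGroup M] [Module R M]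

/-- The sign with which `x` is inserted in front of the wedge product indexed by `s`. -/
def sgn (x : V) (s : Finset V) : ℤ :=
  (-1) ^ (s.filter fun y => Fintype.equivFin V y < Fintype.equivFin V x).card

lemma sgn_mul_self (x : V) (s : Finset V) : sgn x s * sgn x s = 1 := by
  unfold sgn
  rw [← mul_pow]
  simp

lemma sgn_insert {x y : V} {s : Finset V} (hy : y ∉ s) :
    sgn x (insert y s) =
      if Fintype.equivFin V y < Fintype.equivFin V x then -sgn x s else sgn x s := by
  unfold sgn
  rw [Finset.filter_insert]
  split_ifs with h
  · rw [Finset.card_insert_of_notMem (by simp [hy]), pow_succ]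
    ring
  · rfl

/-- Contraction by the basis vector `x` on the exterior algebra with coefficients in `M`,
elements being recorded by their coordinates on the standard basis. -/
def contr (R : Type) [CommRing R] {M : Type} [AddCommGroup M] [Module R M] (x : V) :
    (Finset V → M) →ₗ[R] (Finset V → M) where
  toFun f s := if x ∈ s then 0 else sgn x s • f (insert x s)
  map_add' f g := by ext s; by_cases h : x ∈ s <;> simp [h]
  map_smul' c f := by
    ext s
    by_cases h : x ∈ s
    · simp [h]
    · simp only [h, if_false, Pi.smul_apply, RingHom.id_apply]
      exact smul_comm _ _ _

/-- Left multiplication by the basis vector `z` on the exterior algebra with coefficients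
in `M`. -/
def wedge (R : Type) [CommRing R] {M : Type} [AddCommGroup M] [Module R M] (z : V) :
    (Finset V → M) →ₗ[R] (Finset V → M) where
  toFun f s := if z ∈ s then sgn z (s.erase z) • f (s.erase z) else 0
  map_add' f g := by ext s; by_cases h : z ∈ s <;> simp [h]
  map_smul' c f := by
    ext s
    by_cases h : z ∈ s
    · simp only [h, if_true, Pi.smul_apply, RingHom.id_apply]
      exact smul_comm _ _ _
    · simp [h]

lemma contr_apply (x : V) (f : Finset V → M) (s : Finset V) :
    contr R x f s = if x ∈ s then 0 else sgn x s • f (insert x s) := rfl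

lemma wedge_apply (x : V) (f : Finset V → M) (s : Finset V) :
    wedge R x f s = if x ∈ s then sgn x (s.erase x) • f (s.erase x) else 0 := rfl

lemma contr_contr_self (x : V) (f : Finset V → M) : contr R x (contr R x f) = 0 := by
  ext s
  simp [contr_apply]

lemma equivFin_lt_or {x y : V} (h : x ≠ y) :
    (Fintype.equivFin V x < Fintype.equivFin V y ∧ ¬ Fintype.equivFin V y < Fintype.equivFin V x) ∨
    (Fintype.equivFin V y < Fintype.equivFin V x ∧ ¬ Fintype.equivFin V x < Fintype.equivFin V y) := by
  rcases lt_trichotomy (Fintype.equivFin V x) (Fintype.equivFin V y) with h1 | h1 | h1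
  · exact Or.inl ⟨h1, h1.not_gt⟩
  · exact absurd ((Fintype.equivFin V).injective h1) h
  · exact Or.inr ⟨h1, h1.not_gt⟩

lemma contr_contr {x y : V} (h : x ≠ y) (f : Finset V → M) :
    contr R x (contr R y f) = - contr R y (contr R x f) := by
  ext s
  simp only [contr_apply, Pi.neg_apply]
  by_cases hx : x ∈ s
  · simp [hx]
  by_cases hy : y ∈ s
  · simp [hy]
  have hyx : y ∉ insert x s := by simp [hy, h.symm]
  have hxy : x ∉ insert y s := by simp [hx, h]
  simp only [hx, hy, hyx, hxy, if_false, smul_smul, sgn_insert hx, sgn_insert hy,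
    Finset.insert_comm x y s]
  rw [← neg_smul]
  rcases equivFin_lt_or h with ⟨h1, h2⟩ | ⟨h1, h2⟩ <;> simp [h1, h2, mul_comm]

lemma contr_wedge_self (z : V) (f : Finset V → M) :
    contr R z (wedge R z f) + wedge R z (contr R z f) = f := by
  ext s
  simp only [contr_apply, wedge_apply, Pi.add_apply]
  by_cases hz : z ∈ s
  · simp [hz, Finset.insert_erase hz, smul_smul, sgn_mul_self]
  · simp [hz, Finset.erase_insert hz, smul_smul, sgn_mul_self]

lemma contr_wedge {x z : V} (h : x ≠ z) (f : Finset V → M) :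
    contr R x (wedge R z f) = - wedge R z (contr R x f) := by
  ext s
  simp only [contr_apply, wedge_apply, Pi.neg_apply]
  by_cases hx : x ∈ s
  · simp [hx, h]
  by_cases hz : z ∈ s
  · obtain ⟨t, hzt, rfl⟩ : ∃ t, z ∉ t ∧ s = insert z t :=
      ⟨s.erase z, by simp, (Finset.insert_erase hz).symm⟩
    have hxt : x ∉ t := fun hh => hx (by simp [hh])
    have hzx : z ∉ insert x t := by simp [hzt, h.symm]
    have hxz : x ∉ insert z t := by simp [hxt, h]
    simp only [Finset.mem_insert, h, hxt, Finset.insert_comm x z t, Finset.erase_insert hzx,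
      Finset.erase_insert hzt, sgn_insert hxt, sgn_insert hzt]
    simp only [or_false, if_false, true_or, if_true]
    rw [← neg_smul]
    rcases equivFin_lt_or h with ⟨h1, h2⟩ | ⟨h1, h2⟩ <;> simp [h1, h2] <;>
      exact smul_comm _ _ _
  · simp [hx, hz, h.symm]

/-- The Koszul differential with coefficients `a`. -/
def bdry (a : V → R) : (Finset V → M) →ₗ[R] (Finset V → M) := ∑ x, a x • contr R x

lemma bdry_eq (a : V → R) (f : Finset V → M) : bdry a f = ∑ x, a x • contr R x f := by
  simp [bdry]

lemma bdry_apply (a : V → R) (f : Finset V → M) (s : Finset V) :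
    bdry a f s = ∑ x, a x • (if x ∈ s then 0 else sgn x s • f (insert x s)) := by
  simp [bdry_eq, contr_apply]

lemma contr_bdry (a : V → R) (x : V) (f : Finset V → M) :
    contr R x (bdry a f) = - bdry a (contr R x f) := by
  simp only [bdry_eq, map_sum, map_smul, ← Finset.sum_neg_distrib]
  refine Finset.sum_congr rfl fun y _ => ?_
  by_cases h : x = y
  · subst h; simp [contr_contr_self]
  · rw [contr_contr h, smul_neg]

lemma bdry_bdry (a : V → R) (f : Finset V → M) : bdry a (bdry a f) = 0 := by
  have : bdry a (bdry a f) = ∑ p : V × V, (a p.1 * a p.2) • contr R p.1 (contr R p.2 f) := by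
    simp only [bdry_eq, map_sum, map_smul, Finset.smul_sum, smul_smul, Fintype.sum_prod_type]
    rw [Finset.sum_comm]
    simp only [mul_comm]
  rw [this]
  refine Finset.sum_involution (fun p _ => (p.2, p.1)) ?_ ?_ ?_ ?_
  · rintro ⟨x, y⟩ _
    by_cases h : x = y
    · subst h; simp [contr_contr_self]
    · simp [contr_contr h, mul_comm]
  · rintro ⟨x, y⟩ _ h1 h2
    obtain rfl : y = x := by simpa using congrArg Prod.fst h2
    exact h1 (by simp [contr_contr_self])
  · simp
  · simp

lemma bdry_wedge (a : V → R) (z : V) (f : Finset V → M) :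
    bdry a (wedge R z f) = a z • f - wedge R z (bdry a f) := by
  rw [eq_sub_iff_add_eq, bdry_eq, bdry_eq, map_sum, ← Finset.sum_add_distrib,
    Finset.sum_eq_single z]
  · rw [map_smul, ← smul_add, contr_wedge_self]
  · intro x _ h
    rw [contr_wedge h, map_smul, smul_neg, neg_add_cancel]
  · simp

lemma wedge_wedge_self (z : V) (f : Finset V → M) : wedge R z (wedge R z f) = 0 := by
  ext s
  simp [wedge_apply]

/-- Compatibility of the Koszul differential with the elementary change of basis which
replaces the coefficient `a x` by `a x + c • a w`. -/
lemma bdry_transvection (a : V → R) {x w : V} (c : R) (f : Finset V → M) :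
    bdry a (f + c • wedge R w (contr R x f)) =
      bdry (a + Pi.single x (c * a w)) f +
        c • wedge R w (contr R x (bdry (a + Pi.single x (c * a w)) f)) := by
  have h1 : bdry (a + Pi.single x (c * a w)) f = bdry a f + (c * a w) • contr R x f := by
    simp only [bdry_eq, Pi.add_apply, add_smul, Finset.sum_add_distrib, add_right_inj]
    rw [Finset.sum_eq_single x]
    · simp
    · intro y _ hy; simp [hy]
    · simp
  rw [h1, map_add, map_smul, bdry_wedge, map_add, map_smul, contr_contr_self, smul_zero,
    add_zero, contr_bdry, map_neg, smul_sub, smul_smul, sub_eq_add_neg, smul_neg, add_assoc]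

end Fock


section Koszul

variable {V : Type} [Fintype V] [DecidableEq V]

section Chain

variable {R : Type} [CommRing R] {M M' : Type} [AddCommGroup M] [Module R M]
  [AddCommGroup M'] [Module R M']

/-- Koszul chains of exterior degree `p` with coefficients in `N`. -/
def Chain (V : Type) (N : AddSubgroup M) (p : ℕ) : AddSubgroup (Finset V → M) where
  carrier := {f | (∀ σ, f σ ∈ N) ∧ ∀ σ, σ.card ≠ p → f σ = 0}
  zero_mem' := ⟨fun _ => N.zero_mem, fun _ _ => rfl⟩
  add_mem' hf hg := ⟨fun σ => N.add_mem (hf.1 σ) (hg.1 σ), fun σ h => by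
    simp [hf.2 σ h, hg.2 σ h]⟩
  neg_mem' hf := ⟨fun σ => N.neg_mem (hf.1 σ), fun σ h => by simp [hf.2 σ h]⟩

lemma bdry_map (a : V → R) (L : M →ₗ[R] M') (f : Finset V → M) :
    bdry a (fun σ => L (f σ)) = fun σ => L (bdry a f σ) := by
  ext σ
  simp only [bdry_apply, map_sum, map_smul]
  refine Finset.sum_congr rfl fun x _ => ?_
  split_ifs <;> simp

lemma bdry_mem_Chain {N N' : AddSubgroup M} {a : V → R} (h : ∀ x, ∀ m ∈ N', a x • m ∈ N)
    {p : ℕ} {f : Finset V → M} (hf : f ∈ Chain V N' (p + 1)) : bdry a f ∈ Chain V N p := by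
  refine ⟨fun σ => ?_, fun σ hσ => ?_⟩
  · rw [bdry_apply]
    refine N.sum_mem fun x _ => h x _ ?_
    split_ifs
    · exact N'.zero_mem
    · exact N'.zsmul_mem (hf.1 _) _
  · rw [bdry_apply]
    refine Finset.sum_eq_zero fun x _ => ?_
    split_ifs with hx
    · simp
    · rw [hf.2 (insert x σ) (by rw [Finset.card_insert_of_notMem hx]; omega)]
      simp

lemma wedge_contr_mem_Chain {N : AddSubgroup M} {p : ℕ} {f : Finset V → M}
    (hf : f ∈ Chain V N p) (w x : V) : wedge R w (contr R x f) ∈ Chain V N p := by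
  refine ⟨fun σ => ?_, fun σ hσ => ?_⟩
  · rw [wedge_apply, contr_apply]
    split_ifs
    · simp [N.zero_mem]
    · exact N.zsmul_mem (N.zsmul_mem (hf.1 _) _) _
    · exact N.zero_mem
  · rw [wedge_apply, contr_apply]
    split_ifs with hw hx
    · simp
    · rw [hf.2]
      · simp
      · rw [Finset.card_insert_of_notMem hx, Finset.card_erase_add_one hw]
        exact hσ
    · rfl

lemma mem_Chain_zero {N : AddSubgroup M} {m : M} (h : m ∈ N) :
    (Pi.single ∅ m : Finset V → M) ∈ Chain V N 0 := by
  refine ⟨fun σ => ?_, fun σ hσ => ?_⟩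
  · by_cases hs : σ = ∅
    · subst hs; simpa using h
    · simp [hs, N.zero_mem]
  · rw [Pi.single_eq_of_ne]
    rintro rfl
    simp at hσ

lemma bdry_single_empty (a : V → R) (m : M) : bdry a (Pi.single ∅ m : Finset V → M) = 0 := by
  ext σ
  rw [bdry_apply]
  refine Finset.sum_eq_zero fun x _ => ?_
  rw [Pi.single_eq_of_ne (by simp)]
  simp

end Chain

variable {K : Type} [Field K]

/-- The exponent of the squarefree monomial with support `σ`. -/
def ind (σ : Finset V) : V →₀ ℕ := Finsupp.equivFunOnFinite.symm fun x => if x ∈ σ then 1 else 0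

lemma ind_apply (σ : Finset V) (x : V) : ind σ x = if x ∈ σ then 1 else 0 := rfl

lemma ind_insert {σ : Finset V} {x : V} (h : x ∉ σ) :
    ind (insert x σ) = ind σ + Finsupp.single x 1 := by
  ext y
  rw [Finsupp.add_apply, ind_apply, ind_apply, Finsupp.single_apply]
  by_cases hy : y = x
  · subst hy; simp [h]
  · simp [hy, Ne.symm hy]

/-- The total degree of an exponent. -/
def tdeg : (V →₀ ℕ) →+ ℤ := (Finsupp.weight fun _ => (1 : ℤ))

lemma tdeg_eq (m : V →₀ ℕ) : tdeg m = ∑ x, (m x : ℤ) := by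
  simp [tdeg, Finsupp.weight_apply, Finsupp.sum_fintype]

@[simp] lemma tdeg_single (x : V) (k : ℕ) : tdeg (Finsupp.single x k) = k := by
  simp [tdeg, Finsupp.weight_apply]

lemma tdeg_ind (σ : Finset V) : tdeg (ind σ) = σ.card := by
  simp [tdeg_eq, ind_apply]

/-- The homogeneous polynomials of total degree `e`. -/
def Sg (K : Type) [Field K] (V : Type) [Fintype V] [DecidableEq V] (e : ℤ) :
    AddSubgroup (MvPolynomial V K) :=
  (weightedHomogeneousSubmodule K (fun _ : V => (1 : ℤ)) e).toAddSubgroup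

lemma mem_Sg {e : ℤ} {f : MvPolynomial V K} :
    f ∈ Sg K V e ↔ ∀ m, coeff m f ≠ 0 → tdeg m = e := by
  change IsWeightedHomogeneous _ _ _ ↔ _
  constructor
  · intro h m hm
    exact h hm
  · intro h m hm
    exact h m hm

lemma X_mul_mem_Sg {e : ℤ} {f : MvPolynomial V K} (hf : f ∈ Sg K V e) (x : V) :
    X x * f ∈ Sg K V (e + 1) := by
  have := (isWeightedHomogeneous_X K (fun _ : V => (1 : ℤ)) x).mul hf
  rwa [add_comm] at this

lemma C_mul_mem_Sg {e : ℤ} {f : MvPolynomial V K} (hf : f ∈ Sg K V e) (c : K) :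
    C c * f ∈ Sg K V e := by
  rw [mem_Sg] at hf ⊢
  intro m hm
  rw [coeff_C_mul] at hm
  exact hf m (right_ne_zero_of_mul hm)

/-- The degree `e` part of an ideal. -/
def Ig (I : Ideal (MvPolynomial V K)) (e : ℤ) : AddSubgroup (MvPolynomial V K) :=
  I.toAddSubgroup ⊓ Sg K V e

lemma mem_Ig {I : Ideal (MvPolynomial V K)} {e : ℤ} {f : MvPolynomial V K} :
    f ∈ Ig I e ↔ f ∈ I ∧ f ∈ Sg K V e := Iff.rfl

lemma X_smul_mem_Ig {I : Ideal (MvPolynomial V K)} {e : ℤ} (x : V) (f : MvPolynomial V K)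
    (hf : f ∈ Ig I (e - 1)) : (X x : MvPolynomial V K) • f ∈ Ig I e :=
  ⟨I.mul_mem_left _ hf.1, by simpa using X_mul_mem_Sg hf.2 x⟩

/-- Vanishing of the Koszul homology of `N` in exterior degree `p`, the coefficients having
degree `e`. -/
def Kvan (V : Type) [Fintype V] [DecidableEq V] (K : Type) [Field K] {M : Type} [AddCommGroup M] [Module (MvPolynomial V K) M] (N : ℤ → AddSubgroup M)
    (p : ℕ) (e : ℤ) : Prop :=
  ∀ f ∈ Chain V (N e) p, bdry (X : V → MvPolynomial V K) f = 0 →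
    ∃ b ∈ Chain V (N (e - 1)) (p + 1), bdry (X : V → MvPolynomial V K) b = f

/-- The fine multidegrees in which the Koszul complex of a set of monomials lives. -/
def MonSupp (E : Set (V →₀ ℕ)) (α : V →₀ ℕ) (p : ℕ) (c : Finset V → K) : Prop :=
  ∀ σ, c σ ≠ 0 → σ.card = p ∧ ind σ ≤ α ∧ α - ind σ ∈ E

/-- Vanishing of the Koszul homology of the span of a set of monomials. -/
def MonVan (K : Type) [Field K] (E : Set (V →₀ ℕ)) (p : ℕ) (e : ℤ) : Prop :=
  ∀ α : V →₀ ℕ, tdeg α = p + e → ∀ c : Finset V → K, MonSupp E α p c →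
    bdry (1 : V → K) c = 0 → ∃ b, MonSupp E α (p + 1) b ∧ bdry (1 : V → K) b = c

/-- Extraction of the component of fine multidegree `α` of a Koszul chain. -/
def extr (α : V →₀ ℕ) (f : Finset V → MvPolynomial V K) (σ : Finset V) : K :=
  if ind σ ≤ α then coeff (α - ind σ) (f σ) else 0

lemma bdry_extr (α : V →₀ ℕ) (f : Finset V → MvPolynomial V K) :
    bdry (1 : V → K) (extr α f) = extr α (bdry (X : V → MvPolynomial V K) f) := by
  ext σ
  rw [bdry_apply, extr]
  by_cases h : ind σ ≤ α
  · rw [if_pos h, bdry_apply, coeff_sum]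
    refine Finset.sum_congr rfl fun x _ => ?_
    by_cases hx : x ∈ σ
    · simp [hx]
    simp only [hx, if_false, Pi.one_apply, one_mul, smul_eq_mul, extr]
    rw [mul_smul_comm, coeff_smul]
    congr 1
    rw [coeff_X_mul', ind_insert hx, ← tsub_tsub]
    have e : (ind σ + Finsupp.single x 1 ≤ α) ↔ x ∈ (α - ind σ).support := by
      rw [Finsupp.mem_support_iff]
      constructor
      · intro hh
        have := hh x
        simp [ind_apply, hx] at this ⊢
        omega
      · intro hh
        rw [add_comm, ← le_tsub_iff_right h, Finsupp.single_le_iff]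
        omega
    simp only [e]
  · rw [if_neg h]
    refine Finset.sum_eq_zero fun x _ => ?_
    by_cases hx : x ∈ σ
    · simp [hx]
    simp only [hx, if_false, extr]
    rw [if_neg]
    · simp
    · intro hh
      rw [ind_insert hx] at hh
      exact h (le_trans (by simp) hh)

/-- The Koszul chain of fine multidegree `α` with given scalars. -/
def embed (α : V →₀ ℕ) (c : Finset V → K) (σ : Finset V) : MvPolynomial V K :=
  monomial (α - ind σ) (c σ)

lemma bdry_embed {α : V →₀ ℕ} {c : Finset V → K} (hc : ∀ σ, c σ ≠ 0 → ind σ ≤ α) :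
    bdry (X : V → MvPolynomial V K) (embed α c) = embed α (bdry (1 : V → K) c) := by
  ext1 σ
  rw [bdry_apply, embed, bdry_apply, map_sum]
  refine Finset.sum_congr rfl fun x _ => ?_
  by_cases hx : x ∈ σ
  · simp [hx]
  simp only [hx, if_false, Pi.one_apply, one_mul, smul_eq_mul, embed, map_zsmul]
  rw [mul_smul_comm]
  congr 1
  by_cases h0 : c (insert x σ) = 0
  · simp [h0]
  have h := hc _ h0
  rw [X, monomial_mul, one_mul]
  congr 1
  rw [ind_insert hx] at h ⊢
  rw [← tsub_tsub, add_comm, tsub_add_cancel_of_le]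
  exact le_tsub_of_add_le_left h

lemma extr_embed {α : V →₀ ℕ} {c : Finset V → K} (hc : ∀ σ, c σ ≠ 0 → ind σ ≤ α) :
    extr α (embed α c) = c := by
  ext σ
  rw [extr, embed, coeff_monomial, if_pos rfl]
  split_ifs with h
  · rfl
  · by_contra h0
    exact h (hc σ (Ne.symm h0))

end Koszul


section Semicontinuity

variable {V : Type} [Fintype V] [DecidableEq V] {K : Type} [Field K]

/-- The exponents of the leading monomials of the elements of an ideal. -/
def lead (τ : MonomialOrder V) (I : Ideal (MvPolynomial V K)) : Set (V →₀ ℕ) :=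
  {m | ∃ f ∈ I, f ≠ 0 ∧ τ.degree f = m}

lemma exists_monic_of_mem_lead {A : Type} [AddCommMonoid A] (w : V → A)
    {τ : MonomialOrder V} {I : Ideal (MvPolynomial V K)}
    (hI : ∀ f ∈ I, ∀ a, weightedHomogeneousComponent w a f ∈ I)
    {m : V →₀ ℕ} (hm : m ∈ lead τ I) :
    ∃ f ∈ I, IsWeightedHomogeneous w f (Finsupp.weight w m) ∧ coeff m f = 1 ∧
      ∀ m', coeff m' f ≠ 0 → τ.toSyn m' ≤ τ.toSyn m := by
  classical
  obtain ⟨f, hf, hf0, rfl⟩ := hm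
  have hl : τ.leadingCoeff f ≠ 0 := τ.leadingCoeff_ne_zero_iff.mpr hf0
  refine ⟨C (τ.leadingCoeff f)⁻¹ * weightedHomogeneousComponent w
    (Finsupp.weight w (τ.degree f)) f, I.mul_mem_left _ (hI f hf _), ?_, ?_, ?_⟩
  · intro m hm
    rw [coeff_C_mul] at hm
    exact weightedHomogeneousComponent_isWeightedHomogeneous _ _ (right_ne_zero_of_mul hm)
  · rw [coeff_C_mul, coeff_weightedHomogeneousComponent, if_pos rfl]
    exact inv_mul_cancel₀ hl
  · intro m' hm'
    rw [coeff_C_mul, coeff_weightedHomogeneousComponent] at hm'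
    have h1 := right_ne_zero_of_mul hm'
    split_ifs at h1 with h
    · exact τ.le_degree (mem_support_iff.mpr h1)
    · exact absurd rfl h1

lemma mem_lead_of_max {τ : MonomialOrder V} {I : Ideal (MvPolynomial V K)}
    {f : MvPolynomial V K} (hf : f ∈ I) {m : V →₀ ℕ} (hm : coeff m f ≠ 0)
    (h : ∀ m', coeff m' f ≠ 0 → τ.toSyn m' ≤ τ.toSyn m) : m ∈ lead τ I := by
  have hf0 : f ≠ 0 := by rintro rfl; simp at hm
  refine ⟨f, hf, hf0, τ.toSyn.injective (le_antisymm ?_ (τ.le_degree (mem_support_iff.mpr hm)))⟩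
  exact h _ (τ.leadingCoeff_ne_zero_iff.mpr hf0)

lemma coeff_bdry_ne_zero {g : Finset V → MvPolynomial V K} {σ : Finset V} {m : V →₀ ℕ}
    (h : coeff m (bdry (X : V → MvPolynomial V K) g σ) ≠ 0) :
    ∃ ρ m', coeff m' (g ρ) ≠ 0 ∧ m + ind σ = m' + ind ρ := by
  rw [bdry_apply, coeff_sum] at h
  obtain ⟨x, -, hx⟩ := Finset.exists_ne_zero_of_sum_ne_zero h
  by_cases hxσ : x ∈ σ
  · simp [hxσ] at hx
  · simp only [hxσ, if_false, smul_eq_mul, mul_smul_comm, coeff_smul] at hx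
    have hx' := right_ne_zero_of_smul hx
    rw [coeff_X_mul'] at hx'
    split_ifs at hx' with h1
    · refine ⟨_, _, hx', ?_⟩
      have h2 : Finsupp.single x 1 ≤ m := by
        rw [Finsupp.single_le_iff]
        exact Nat.one_le_iff_ne_zero.mpr (Finsupp.mem_support_iff.mp h1)
      rw [ind_insert hxσ, add_comm (ind σ), ← add_assoc, tsub_add_cancel_of_le h2]
    · exact absurd rfl hx'

theorem Kvan_of_MonVan_lead (τ : MonomialOrder V) {I : Ideal (MvPolynomial V K)}
    (hI : ∀ f ∈ I, ∀ a, weightedHomogeneousComponent (fun _ : V => (1 : ℤ)) a f ∈ I)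
    {p : ℕ} {e : ℤ} (h : MonVan K (lead τ I) p e) : Kvan V K (Ig I) p e := by
  suffices H : ∀ a : WithTop τ.syn, ∀ f ∈ Chain V (Ig I e) p, bdry (X : V → MvPolynomial V K) f = 0 →
      (∀ σ m, coeff m (f σ) ≠ 0 → (τ.toSyn (m + ind σ) : WithTop τ.syn) < a) →
      ∃ b ∈ Chain V (Ig I (e - 1)) (p + 1), bdry (X : V → MvPolynomial V K) b = f by
    intro f hf hf0
    exact H ⊤ f hf hf0 fun σ m _ => WithTop.coe_lt_top _
  intro a
  induction a using WellFoundedLT.induction with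
  | _ a IH =>
  intro f hf hf0 hlt
  let T : Finset τ.syn := Finset.univ.biUnion fun σ : Finset V =>
    (f σ).support.image fun m => τ.toSyn (m + ind σ)
  have hT : ∀ σ m, coeff m (f σ) ≠ 0 → τ.toSyn (m + ind σ) ∈ T := by
    intro σ m hm
    simp only [T, Finset.mem_biUnion, Finset.mem_image, Finset.mem_univ, true_and]
    exact ⟨σ, m, mem_support_iff.mpr hm, rfl⟩
  rcases T.eq_empty_or_nonempty with hTe | hTe
  · refine ⟨0, zero_mem _, ?_⟩
    rw [map_zero]
    ext σ m
    by_contra hne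
    have := hT σ m (by simpa using Ne.symm hne)
    simp [hTe] at this
  have hsup : ∃ t ∈ T, ∀ t' ∈ T, t' ≤ t := T.exists_max_image id hTe
  obtain ⟨t, htT, htmax⟩ := hsup
  obtain ⟨σ₀, m₀, hm₀, rfl⟩ : ∃ σ m, coeff m (f σ) ≠ 0 ∧ τ.toSyn (m + ind σ) = t := by
    simpa [T] using htT
  set α := m₀ + ind σ₀ with hα
  have hle : ∀ σ m, coeff m (f σ) ≠ 0 → τ.toSyn (m + ind σ) ≤ τ.toSyn α :=
    fun σ m hm => htmax _ (hT σ m hm)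
  have hcard : σ₀.card = p := by
    by_contra hne
    rw [hf.2 σ₀ hne] at hm₀
    simp at hm₀
  have hdeg : tdeg α = p + e := by
    rw [hα, map_add, tdeg_ind, hcard, mem_Sg.mp (hf.1 σ₀).2 m₀ hm₀, add_comm]
  obtain ⟨c, hc, hbc⟩ := h α hdeg (extr α f) (by
    intro σ hσ
    unfold extr at hσ
    split_ifs at hσ with hs
    · refine ⟨?_, hs, ?_⟩
      · by_contra hne
        rw [hf.2 σ hne] at hσ
        simp at hσ
      · refine mem_lead_of_max (hf.1 σ).1 hσ fun m' hm' => ?_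
        have := hle σ m' hm'
        rw [← tsub_add_cancel_of_le hs, map_add, map_add] at this
        exact le_of_add_le_add_right this
    · exact absurd rfl hσ) (by rw [bdry_extr, hf0]; ext σ; simp [extr])
  have hex : ∀ σ, ∃ g ∈ Ig I (e - 1), (c σ ≠ 0 → coeff (α - ind σ) g = 1 ∧
      ∀ m', coeff m' g ≠ 0 → τ.toSyn m' ≤ τ.toSyn (α - ind σ)) := by
    intro σ
    by_cases hσ : c σ = 0
    · exact ⟨0, zero_mem _, fun h => absurd hσ h⟩
    · obtain ⟨h1, h2, h3⟩ := hc σ hσ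
      obtain ⟨g, hg, hgh, hg1, hg2⟩ := exists_monic_of_mem_lead _ hI h3
      refine ⟨g, ⟨hg, ?_⟩, fun _ => ⟨hg1, hg2⟩⟩
      have : (Finsupp.weight (fun _ : V => (1 : ℤ))) (α - ind σ) = e - 1 := by
        change tdeg _ = _
        have := congrArg tdeg (tsub_add_cancel_of_le h2)
        rw [map_add, hdeg, tdeg_ind, h1] at this
        push_cast at this
        linarith
      rw [this] at hgh
      exact hgh
  choose g hg hg1 using hex
  set G : Finset V → MvPolynomial V K := fun σ => C (c σ) * g σ with hG
  have hGC : G ∈ Chain V (Ig I (e - 1)) (p + 1) := by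
    refine ⟨fun σ => ⟨I.mul_mem_left _ (hg σ).1, C_mul_mem_Sg (hg σ).2 _⟩, fun σ hσ => ?_⟩
    have : c σ = 0 := by
      by_contra h0
      exact hσ (hc σ h0).1
    simp [hG, this]
  have hGe : extr α G = c := by
    ext σ
    unfold extr
    by_cases hσ : c σ = 0
    · simp [hG, hσ]
    · rw [if_pos (hc σ hσ).2.1, hG, coeff_C_mul, (hg1 σ hσ).1, mul_one]
  have hGle : ∀ σ m, coeff m (G σ) ≠ 0 → τ.toSyn (m + ind σ) ≤ τ.toSyn α := by
    intro σ m hm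
    rw [hG, coeff_C_mul] at hm
    have hσ := left_ne_zero_of_mul hm
    have := (hg1 σ hσ).2 m (right_ne_zero_of_mul hm)
    rw [← tsub_add_cancel_of_le (hc σ hσ).2.1, map_add, map_add]
    exact add_le_add_left this _
  have hfG : f - bdry (X : V → MvPolynomial V K) G ∈ Chain V (Ig I e) p :=
    sub_mem hf (bdry_mem_Chain (fun x m hm => X_smul_mem_Ig x m hm) hGC)
  have hlt' : ∀ σ m, coeff m ((f - bdry (X : V → MvPolynomial V K) G) σ) ≠ 0 → τ.toSyn (m + ind σ) < τ.toSyn α := by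
    intro σ m hm
    refine lt_of_le_of_ne ?_ ?_
    · rw [Pi.sub_apply, coeff_sub] at hm
      by_cases h1 : coeff m (f σ) = 0
      · rw [h1, zero_sub, neg_ne_zero] at hm
        obtain ⟨ρ, m', hm', he⟩ := coeff_bdry_ne_zero hm
        rw [he]
        exact hGle ρ m' hm'
      · exact hle σ m h1
    · intro heq
      have heq := τ.toSyn.injective heq
      have h1 : extr α (f - bdry (X : V → MvPolynomial V K) G) σ = 0 := by
        have : extr α (f - bdry (X : V → MvPolynomial V K) G) σ = extr α f σ - extr α (bdry (X : V → MvPolynomial V K) G) σ := by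
          unfold extr
          split_ifs <;> simp
        rw [this, ← bdry_extr, hGe, hbc, sub_self]
      unfold extr at h1
      rw [if_pos (by rw [← heq]; simp), ← heq, add_tsub_cancel_right] at h1
      exact hm h1
  obtain ⟨b, hb, hbb⟩ := IH (τ.toSyn α : WithTop τ.syn) (hlt _ _ hm₀) (f - bdry (X : V → MvPolynomial V K) G) hfG
    (by rw [map_sub, hf0, bdry_bdry, sub_zero]) fun σ m hm => WithTop.coe_lt_coe.mpr (hlt' σ m hm)
  exact ⟨b + G, add_mem hb hGC, by rw [map_add, hbb, sub_add_cancel]⟩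

end Semicontinuity


section Transvection

variable {V : Type} [Fintype V] [DecidableEq V] {K : Type} [Field K]

/-- The monomial ideal spanned by the monomials with exponent in the upper set `E`. -/
def monIdeal (K : Type) [Field K] (E : Set (V →₀ ℕ)) : Ideal (MvPolynomial V K) where
  carrier := {f | ∀ m, coeff m f ≠ 0 → ∀ n, m + n ∈ E}
  zero_mem' := fun m hm => absurd (coeff_zero m) hm
  add_mem' := fun {f g} hf hg m hm => by
    rw [coeff_add] at hm
    by_cases h : coeff m f = 0
    · rw [h, zero_add] at hm
      exact hg m hm
    · exact hf m h
  smul_mem' := fun c f hf m hm n => by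
    rw [smul_eq_mul, coeff_mul] at hm
    obtain ⟨⟨a, b⟩, hab, hne⟩ := Finset.exists_ne_zero_of_sum_ne_zero hm
    rw [Finset.HasAntidiagonal.mem_antidiagonal] at hab
    have := hf b (right_ne_zero_of_mul hne) (a + n)
    rw [← hab]
    simpa only [add_assoc, add_left_comm, add_comm] using this

lemma mem_monIdeal {E : Set (V →₀ ℕ)} (hE : IsUpperSet E) {f : MvPolynomial V K} :
    f ∈ monIdeal K E ↔ ∀ m, coeff m f ≠ 0 → m ∈ E := by
  constructor
  · intro h m hm
    simpa using h m hm 0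
  · intro h m hm n
    exact hE (by simp) (h m hm)

lemma component_mem_monIdeal {A : Type} [AddCommMonoid A] (w : V → A) {E : Set (V →₀ ℕ)}
    {f : MvPolynomial V K} (hf : f ∈ monIdeal K E) (a : A) :
    weightedHomogeneousComponent w a f ∈ monIdeal K E := by
  classical
  intro m hm
  rw [coeff_weightedHomogeneousComponent] at hm
  split_ifs at hm
  · exact hf m hm
  · exact absurd rfl hm

theorem MonVan_of_Kvan_monIdeal {E : Set (V →₀ ℕ)} (hE : IsUpperSet E) {p : ℕ} {e : ℤ}
    (h : Kvan V K (Ig (monIdeal K E)) p e) : MonVan K E p e := by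
  intro α hα c hc hc0
  have hle : ∀ σ, c σ ≠ 0 → ind σ ≤ α := fun σ hσ => (hc σ hσ).2.1
  obtain ⟨b, hb, hbb⟩ := h (embed α c) (by
    refine ⟨fun σ => ⟨?_, ?_⟩, fun σ hσ => ?_⟩
    · refine (mem_monIdeal hE).mpr fun m hm => ?_
      rw [embed, coeff_monomial] at hm
      split_ifs at hm with he
      · rw [← he]
        exact (hc σ hm).2.2
      · exact absurd rfl hm
    · refine mem_Sg.mpr fun m hm => ?_
      rw [embed, coeff_monomial] at hm
      split_ifs at hm with he
      · have := congrArg tdeg (tsub_add_cancel_of_le (hle σ hm))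
        rw [map_add, hα, tdeg_ind, (hc σ hm).1] at this
        rw [← he]
        linarith
      · exact absurd rfl hm
    · have : c σ = 0 := by
        by_contra h0
        exact hσ (hc σ h0).1
      simp [embed, this]) (by rw [bdry_embed hle, hc0]; ext1 σ; simp [embed])
  refine ⟨extr α b, fun σ hσ => ?_, by rw [bdry_extr, hbb, extr_embed hle]⟩
  unfold extr at hσ
  split_ifs at hσ with hs
  · refine ⟨?_, hs, (mem_monIdeal hE).mp (hb.1 σ).1 _ hσ⟩
    by_contra hne
    rw [hb.2 σ hne] at hσ
    simp at hσ
  · exact absurd rfl hσ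

/-- The substitution `X x ↦ X x + c X w`. -/
def trans (x w : V) (c : K) : MvPolynomial V K →ₐ[K] MvPolynomial V K :=
  aeval fun y => X y + if y = x then C c * X w else 0

lemma trans_X (x w : V) (c : K) (y : V) :
    trans x w c (X y) = X y + if y = x then C c * X w else 0 := by
  simp [trans]

lemma trans_trans {x w : V} (h : x ≠ w) (c : K) (f : MvPolynomial V K) :
    trans x w (-c) (trans x w c f) = f := by
  have : (trans x w (-c)).comp (trans x w c) = AlgHom.id K _ := by
    ext1 y
    simp only [AlgHom.comp_apply, trans_X, map_add, AlgHom.id_apply]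
    split_ifs with hy
    · rw [map_mul, trans_X, if_neg h.symm, ← MvPolynomial.algebraMap_eq, AlgHom.commutes]
      simp
    · simp
  exact DFunLike.congr_fun this f

lemma bdry_algHom (φ : MvPolynomial V K →ₐ[K] MvPolynomial V K) (a : V → MvPolynomial V K)
    (f : Finset V → MvPolynomial V K) :
    bdry (fun x => φ (a x)) (fun σ => φ (f σ)) = fun σ => φ (bdry a f σ) := by
  ext1 σ
  simp only [bdry_apply, map_sum, smul_eq_mul, map_mul]
  refine Finset.sum_congr rfl fun x _ => ?_
  split_ifs <;> simp

lemma trans_isWeightedHomogeneous {A : Type} [AddCommMonoid A] {u : V → A} {x w : V}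
    (h : u x = u w) (c : K) {a : A} {f : MvPolynomial V K} (hf : IsWeightedHomogeneous u f a) :
    IsWeightedHomogeneous u (trans x w c f) a := by
  rw [f.as_sum, map_sum]
  refine IsWeightedHomogeneous.sum _ _ _ fun m hm => ?_
  rw [← hf (mem_support_iff.mp hm), trans, aeval_monomial, Finsupp.weight_apply,
    MvPolynomial.algebraMap_eq]
  refine IsWeightedHomogeneous.C_mul ?_ _
  refine IsWeightedHomogeneous.prod _ _ _ fun y _ => IsWeightedHomogeneous.pow ?_ _
  refine (isWeightedHomogeneous_X K u y).add ?_
  split_ifs with hy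
  · rw [hy, h]
    exact (isWeightedHomogeneous_X K u w).C_mul c
  · exact isWeightedHomogeneous_zero K u _

lemma trans_mem_Sg {x w : V} (c : K) {e : ℤ} {f : MvPolynomial V K} (hf : f ∈ Sg K V e) :
    trans x w c f ∈ Sg K V e :=
  trans_isWeightedHomogeneous (u := fun _ => (1 : ℤ)) rfl c hf

/-- The change of basis of the exterior algebra attached to a transvection. -/
def tw (x w : V) (f : Finset V → MvPolynomial V K) : Finset V → MvPolynomial V K :=
  f + wedge (MvPolynomial V K) w (contr (MvPolynomial V K) x f)

/-- The inverse of `tw`. -/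
def twInv (x w : V) (f : Finset V → MvPolynomial V K) : Finset V → MvPolynomial V K :=
  f - wedge (MvPolynomial V K) w (contr (MvPolynomial V K) x f)

lemma wedge_contr_wedge {x w : V} (hxw : x ≠ w) (g : Finset V → MvPolynomial V K) :
    wedge (MvPolynomial V K) w (contr (MvPolynomial V K) x (wedge (MvPolynomial V K) w g)) = 0 := by
  rw [contr_wedge hxw, map_neg, wedge_wedge_self, neg_zero]

lemma tw_twInv {x w : V} (hxw : x ≠ w) (f : Finset V → MvPolynomial V K) :
    tw x w (twInv x w f) = f := by
  unfold tw twInv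
  rw [map_sub, map_sub, wedge_contr_wedge hxw, sub_zero, sub_add_cancel]

lemma twInv_tw {x w : V} (hxw : x ≠ w) (f : Finset V → MvPolynomial V K) :
    twInv x w (tw x w f) = f := by
  unfold tw twInv
  rw [map_add, map_add, wedge_contr_wedge hxw, add_zero, add_sub_cancel_right]

lemma bdry_tw (x w : V) (f : Finset V → MvPolynomial V K) :
    bdry (X : V → MvPolynomial V K) (tw x w f) = tw x w (bdry (fun y => trans x w (1 : K) (X y)) f) := by
  have h : (fun y => trans x w (1 : K) (X y)) =
      (X : V → MvPolynomial V K) + Pi.single x (1 * X w) := by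
    ext1 y
    rw [trans_X, Pi.add_apply, Pi.single_apply, map_one]
  have hΘ := bdry_transvection (M := MvPolynomial V K) (X : V → MvPolynomial V K)
    (x := x) (w := w) 1 f
  rw [← h] at hΘ
  simp only [one_smul] at hΘ
  exact hΘ

lemma trans_apply_mem_Chain {I I' : Ideal (MvPolynomial V K)} {x w : V} {c : K}
    (h : ∀ f ∈ I, trans x w c f ∈ I') {p : ℕ} {e : ℤ} {f : Finset V → MvPolynomial V K}
    (hf : f ∈ Chain V (Ig I e) p) : (fun σ => trans x w c (f σ)) ∈ Chain V (Ig I' e) p :=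
  ⟨fun σ => ⟨h _ (hf.1 σ).1, trans_mem_Sg _ (hf.1 σ).2⟩, fun σ hσ => by
    simp only [hf.2 σ hσ, map_zero]⟩

theorem Kvan_of_comap_trans {I : Ideal (MvPolynomial V K)} {x w : V} (hxw : x ≠ w) {p : ℕ}
    {e : ℤ} (h : Kvan V K (Ig (I.comap (trans x w (-1 : K)))) p e) : Kvan V K (Ig I) p e := by
  intro f hf hf0
  have hφf := trans_apply_mem_Chain (I' := I.comap (trans x w (-1 : K))) (c := (1 : K))
    (fun f hf => by rwa [Ideal.mem_comap, trans_trans hxw]) hf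
  have hcyc := bdry_algHom (trans x w (1 : K)) (X : V → MvPolynomial V K) f
  rw [hf0] at hcyc
  obtain ⟨b, hb, hbb⟩ := h (tw x w fun σ => trans x w (1 : K) (f σ))
    (add_mem hφf (wedge_contr_mem_Chain (R := MvPolynomial V K) hφf w x)) (by
      rw [bdry_tw, hcyc]
      simp only [Pi.zero_apply, map_zero]
      change tw x w 0 = 0
      simp [tw])
  have hb' : twInv x w b ∈ Chain V (Ig (I.comap (trans x w (-1 : K))) (e - 1)) (p + 1) :=
    sub_mem hb (wedge_contr_mem_Chain (R := MvPolynomial V K) hb w x)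
  have hbb' : bdry (fun y => trans x w (1 : K) (X y)) (twInv x w b) =
      fun σ => trans x w (1 : K) (f σ) := by
    rw [← twInv_tw hxw (bdry _ _), ← bdry_tw, tw_twInv hxw, hbb, twInv_tw hxw]
  refine ⟨_, trans_apply_mem_Chain (c := (-1 : K)) (fun f hf => hf) hb', ?_⟩
  have h3 := bdry_algHom (trans x w (-1 : K)) (fun y => trans x w (1 : K) (X y)) (twInv x w b)
  simp only [hbb', trans_trans hxw] at h3
  exact h3

theorem MonVan_univ {p : ℕ} {e : ℤ} (h : p ≠ 0 ∨ e ≠ 0) :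
    MonVan K (Set.univ : Set (V →₀ ℕ)) p e := by
  intro α hα c hc hc0
  by_cases h0 : α = 0
  · refine ⟨0, fun σ hσ => absurd rfl hσ, ?_⟩
    rw [map_zero]
    ext σ
    by_contra hne
    obtain ⟨h1, h2, -⟩ := hc σ (Ne.symm hne)
    have h3 : σ = ∅ := by
      rw [Finset.eq_empty_iff_forall_notMem]
      intro y hy
      have := h2 y
      simp [h0, ind_apply, hy] at this
    subst h3
    rw [h0, map_zero] at hα
    rw [Finset.card_empty] at h1
    subst h1
    simp at h hα
    exact h hα.symm
  · obtain ⟨z, hz⟩ := Finsupp.ne_iff.mp h0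
    refine ⟨wedge K z c, fun σ hσ => ?_, by rw [bdry_wedge, hc0]; simp⟩
    rw [wedge_apply] at hσ
    split_ifs at hσ with hzσ
    · have h1 : c (σ.erase z) ≠ 0 := right_ne_zero_of_smul hσ
      obtain ⟨h2, h3, -⟩ := hc _ h1
      refine ⟨by rw [← h2, Finset.card_erase_add_one hzσ], fun y => ?_, trivial⟩
      have := h3 y
      by_cases hy : y = z
      · subst hy
        simp [ind_apply, hzσ] at hz ⊢
        omega
      · simpa [ind_apply, hy] using this
    · exact absurd rfl hσ

end Transvection


section Resolution

variable {V : Type} [Fintype V] [DecidableEq V] {K : Type} [Field K]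

section Lift

variable {F M : Type} [AddCommGroup F] [Module (MvPolynomial V K) F] [AddCommGroup M]
  [Module (MvPolynomial V K) M]

/-- A boundary with coefficients in the kernel of a graded surjection comes from the kernel
when the Koszul homology of the target vanishes. -/
lemma exists_bdry_eq_of_Kvan (L : F →ₗ[MvPolynomial V K] M) {NF : ℤ → AddSubgroup F}
    {NM : ℤ → AddSubgroup M} (hX : ∀ e x, ∀ m ∈ NF (e - 1), (X x : MvPolynomial V K) • m ∈ NF e)
    (hL : ∀ e, ∀ f ∈ NF e, L f ∈ NM e) (hs : ∀ e, ∀ m ∈ NM e, ∃ f ∈ NF e, L f = m) {p : ℕ} {e : ℤ}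
    (hv : Kvan V K NM (p + 1) (e - 1)) {b : Finset V → F} (hb : b ∈ Chain V (NF (e - 1)) (p + 1))
    (h0 : ∀ σ, L (bdry (X : V → MvPolynomial V K) b σ) = 0) :
    ∃ b' ∈ Chain V (NF (e - 1)) (p + 1), (∀ σ, L (b' σ) = 0) ∧
      bdry (X : V → MvPolynomial V K) b' = bdry (X : V → MvPolynomial V K) b := by
  obtain ⟨c, hc, hcb⟩ := hv (fun σ => L (b σ)) ⟨fun σ => hL _ _ (hb.1 σ), fun σ hσ => by
    simp only [hb.2 σ hσ, map_zero]⟩ (by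
      rw [bdry_map]
      ext1 σ
      exact h0 σ)
  have hl : ∀ σ, ∃ g ∈ NF (e - 1 - 1), L g = c σ ∧ (c σ = 0 → g = 0) := by
    intro σ
    by_cases h : c σ = 0
    · exact ⟨0, zero_mem _, by rw [h, map_zero], fun _ => rfl⟩
    · obtain ⟨g, hg, hgc⟩ := hs _ _ (hc.1 σ)
      exact ⟨g, hg, hgc, fun h' => absurd h' h⟩
  choose g hg hgc hg0 using hl
  have hgC : g ∈ Chain V (NF (e - 1 - 1)) (p + 1 + 1) := ⟨hg, fun σ hσ => hg0 σ (hc.2 σ hσ)⟩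
  refine ⟨b - bdry (X : V → MvPolynomial V K) g, sub_mem hb (bdry_mem_Chain (hX _) hgC), ?_, ?_⟩
  · intro σ
    have h1 := congrFun (bdry_map (X : V → MvPolynomial V K) L g) σ
    simp only [hgc] at h1
    have h2 : bdry (X : V → MvPolynomial V K) (fun σ => c σ) σ = L (b σ) := congrFun hcb σ
    rw [Pi.sub_apply, map_sub, ← h1, h2, sub_self]
  · rw [map_sub, bdry_bdry, sub_zero]

end Lift

section Free

variable {κ : Type}

/-- The degree `e` part of the free module whose basis elements have degrees `d`. -/
def Fg (K : Type) [Field K] (V : Type) [Fintype V] [DecidableEq V] (d : κ → ℕ) (e : ℤ) :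
    AddSubgroup (κ →₀ MvPolynomial V K) where
  carrier := {f | ∀ j, f j ∈ Sg K V (e - d j)}
  zero_mem' := fun _ => zero_mem _
  add_mem' hf hg j := add_mem (hf j) (hg j)
  neg_mem' hf j := neg_mem (hf j)

lemma X_smul_mem_Fg {d : κ → ℕ} (e : ℤ) (x : V) (f : κ →₀ MvPolynomial V K)
    (hf : f ∈ Fg K V d (e - 1)) : (X x : MvPolynomial V K) • f ∈ Fg K V d e := by
  intro j
  have := X_mul_mem_Sg (hf j) x
  rw [sub_right_comm, sub_add_cancel] at this
  exact this

/-- The projection to the homogeneous polynomials of degree `e`. -/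
def comp (K : Type) [Field K] (V : Type) [Fintype V] [DecidableEq V] (e : ℤ) :
    MvPolynomial V K →ₗ[K] MvPolynomial V K :=
  weightedHomogeneousComponent (fun _ : V => (1 : ℤ)) e

lemma comp_mem (e : ℤ) (f : MvPolynomial V K) : comp K V e f ∈ Sg K V e :=
  weightedHomogeneousComponent_isWeightedHomogeneous _ _

lemma comp_of_mem {e : ℤ} {f : MvPolynomial V K} (hf : f ∈ Sg K V e) : comp K V e f = f :=
  IsWeightedHomogeneous.weightedHomogeneousComponent_same hf

lemma comp_mul {b : ℤ} {g : MvPolynomial V K} (hg : g ∈ Sg K V b) (e : ℤ)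
    (f : MvPolynomial V K) : comp K V (e + b) (f * g) = comp K V e f * g := by
  induction f using MvPolynomial.induction_on' with
  | monomial m c =>
    have h1 : IsWeightedHomogeneous (fun _ : V => (1 : ℤ)) (monomial m c) (tdeg m) :=
      isWeightedHomogeneous_monomial _ _ _ rfl
    have h2 := h1.mul hg
    by_cases h : tdeg m = e
    · subst h
      rw [comp, comp, h1.weightedHomogeneousComponent_same, h2.weightedHomogeneousComponent_same]
    · rw [comp, comp, h1.weightedHomogeneousComponent_ne _ (Ne.symm h),
        h2.weightedHomogeneousComponent_ne _ (fun h' => h (add_right_cancel h').symm), zero_mul]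
  | add f₁ f₂ h1 h2 => rw [add_mul, map_add, map_add, h1, h2, add_mul]

/-- The projection to the degree `e` part of a graded free module. -/
def fcomp (K : Type) [Field K] (V : Type) [Fintype V] [DecidableEq V] (d : κ → ℕ) (e : ℤ) :
    (κ →₀ MvPolynomial V K) →+ (κ →₀ MvPolynomial V K) :=
  Finsupp.liftAddHom fun j =>
    (Finsupp.singleAddHom j).comp (comp K V (e - d j)).toAddMonoidHom

lemma fcomp_single (d : κ → ℕ) (e : ℤ) (j : κ) (s : MvPolynomial V K) :
    fcomp K V d e (Finsupp.single j s) = Finsupp.single j (comp K V (e - d j) s) := by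
  simp [fcomp]

lemma fcomp_apply (d : κ → ℕ) (e : ℤ) (f : κ →₀ MvPolynomial V K) (j : κ) :
    fcomp K V d e f j = comp K V (e - d j) (f j) := by
  classical
  induction f using Finsupp.induction_linear with
  | zero => simp
  | add f g hf hg => simp [hf, hg]
  | single i s =>
    rw [fcomp_single, Finsupp.single_apply, Finsupp.single_apply]
    split_ifs with h
    · rw [h]
    · simp

lemma fcomp_mem (d : κ → ℕ) (e : ℤ) (f : κ →₀ MvPolynomial V K) :
    fcomp K V d e f ∈ Fg K V d e := fun j => by
  rw [fcomp_apply]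
  exact comp_mem _ _

lemma comp_map {d : κ → ℕ} {c : ℤ} (L : (κ →₀ MvPolynomial V K) →ₗ[MvPolynomial V K]
    MvPolynomial V K) (hL : ∀ i, L (Finsupp.single i 1) ∈ Sg K V (d i - c)) (e : ℤ)
    (f : κ →₀ MvPolynomial V K) : comp K V (e - c) (L f) = L (fcomp K V d e f) := by
  have hs : ∀ i s, L (Finsupp.single i s) = s * L (Finsupp.single i 1) := by
    intro i s
    rw [← smul_eq_mul, ← map_smul, Finsupp.smul_single, smul_eq_mul, mul_one]
  induction f using Finsupp.induction_linear with
  | zero => simp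
  | add f g hf hg => simp only [map_add, hf, hg]
  | single i s =>
    rw [fcomp_single, hs, hs i (comp K V _ s), ← comp_mul (hL i)]
    congr 2
    ring

lemma map_mem_Sg {d : κ → ℕ} {c : ℤ} (L : (κ →₀ MvPolynomial V K) →ₗ[MvPolynomial V K]
    MvPolynomial V K) (hL : ∀ i, L (Finsupp.single i 1) ∈ Sg K V (d i - c)) {e : ℤ}
    {f : κ →₀ MvPolynomial V K} (hf : f ∈ Fg K V d e) : L f ∈ Sg K V (e - c) := by
  have : fcomp K V d e f = f := by
    ext1 j
    rw [fcomp_apply, comp_of_mem (hf j)]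
  rw [← this, ← comp_map L hL]
  exact comp_mem _ _

lemma Kvan_Sg {p : ℕ} {e : ℤ} (h : p ≠ 0 ∨ e ≠ 0) : Kvan V K (Sg K V) p e := by
  by_cases hτ : Nonempty (MonomialOrder V)
  · obtain ⟨τ⟩ := hτ
    have h1 : Kvan V K (Ig (⊤ : Ideal (MvPolynomial V K))) p e := by
      refine Kvan_of_MonVan_lead τ (fun _ _ _ => Submodule.mem_top) ?_
      have hu : lead τ (⊤ : Ideal (MvPolynomial V K)) = Set.univ := by
        refine Set.eq_univ_of_forall fun m => ?_
        refine mem_lead_of_max (f := monomial m (1 : K)) Submodule.mem_top (by simp) fun m' hm' => ?_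
        classical
        rw [coeff_monomial] at hm'
        split_ifs at hm' with h
        · rw [h]
        · exact absurd rfl hm'
      rw [hu]
      exact MonVan_univ h
    have h2 : Ig (⊤ : Ideal (MvPolynomial V K)) = Sg K V := by
      ext e f
      simp [mem_Ig]
    rwa [h2] at h1
  · exfalso
    apply hτ
    letI : LinearOrder V := LinearOrder.lift' (Fintype.equivFin V) (Fintype.equivFin V).injective
    exact ⟨MonomialOrder.lex⟩

lemma Kvan_Fg_aux [Finite κ] {d : κ → ℕ} {p : ℕ} {e : ℤ} {f : Finset V → κ →₀ MvPolynomial V K}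
    (hf : f ∈ Chain V (Fg K V d e) p) (hf0 : bdry (X : V → MvPolynomial V K) f = 0)
    (h : ∀ j, p ≠ 0 ∨ e - d j ≠ 0 ∨ ∀ σ, f σ j = 0) :
    ∃ b ∈ Chain V (Fg K V d (e - 1)) (p + 1), bdry (X : V → MvPolynomial V K) b = f := by
  have hj : ∀ j, ∃ b ∈ Chain V (Sg K V (e - d j - 1)) (p + 1),
      bdry (X : V → MvPolynomial V K) b = fun σ => f σ j := by
    intro j
    rcases or_assoc.mpr (h j) with h1 | h1
    · refine Kvan_Sg h1 _ ⟨fun σ => hf.1 σ j, fun σ hσ => by simp only [hf.2 σ hσ]; rfl⟩ ?_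
      have := bdry_map (X : V → MvPolynomial V K) (Finsupp.lapply j) f
      simp only [Finsupp.lapply_apply, hf0] at this
      rw [this]
      rfl
    · refine ⟨0, zero_mem _, ?_⟩
      ext1 σ
      rw [map_zero, h1]
      rfl
  choose b hb hbf using hj
  refine ⟨fun σ => Finsupp.equivFunOnFinite.symm fun j => b j σ, ⟨fun σ j => ?_, fun σ hσ => ?_⟩, ?_⟩
  · have := (hb j).1 σ
    rw [sub_right_comm] at this
    exact this
  · ext1 j
    exact (hb j).2 σ hσ
  · ext1 σ
    ext1 j
    have := bdry_map (X : V → MvPolynomial V K) (Finsupp.lapply j)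
      fun σ => Finsupp.equivFunOnFinite.symm fun j => b j σ
    have h2 := congrFun this σ
    rw [Finsupp.lapply_apply] at h2
    rw [← h2]
    exact congrFun (hbf j) σ

lemma Kvan_Fg [Finite κ] {d : κ → ℕ} {p : ℕ} (hp : p ≠ 0) (e : ℤ) : Kvan V K (Fg K V d) p e :=
  fun _ hf hf0 => Kvan_Fg_aux hf hf0 fun _ => Or.inl hp

end Free

variable {I : Ideal (MvPolynomial V K)}

lemma mem_Sg_of_nat {f : MvPolynomial V K} {k : ℕ}
    (hf : IsWeightedHomogeneous (fun _ : V => (1 : ℕ)) f k) : f ∈ Sg K V k := by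
  rw [mem_Sg]
  intro m hm
  rw [← hf hm, tdeg_eq]
  simp [Finsupp.weight_apply, Finsupp.sum_fintype]

variable (F : GradedFreeResolution V K ℕ (fun _ => 1) I)

lemma aug_single_mem (i : F.ι 0) : F.aug (Finsupp.single i 1) ∈ Sg K V (F.deg 0 i - 0) := by
  rw [sub_zero]
  exact mem_Sg_of_nat (F.aug_graded i)

lemma d_single_mem (p : ℕ) (j : F.ι p) (i : F.ι (p + 1)) :
    ((Finsupp.lapply j).comp (F.d p)) (Finsupp.single i 1) ∈
      Sg K V (F.deg (p + 1) i - F.deg p j) := by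
  change F.d p (Finsupp.single i 1) j ∈ _
  rcases F.d_graded p i j with h | ⟨b, hb, hd⟩
  · rw [h]
    exact zero_mem _
  · rw [← hd]
    push_cast
    rw [add_sub_cancel_right]
    exact mem_Sg_of_nat hb

/-- The degree `e` part of the syzygies in the `k`-th module of a resolution. -/
def Rg (k : ℕ) (e : ℤ) : AddSubgroup (F.ι k →₀ MvPolynomial V K) :=
  Fg K V (F.deg k) e ⊓ (LinearMap.range (F.d k)).toAddSubgroup

lemma d_mem_Rg {k : ℕ} {e : ℤ} {f : F.ι (k + 1) →₀ MvPolynomial V K}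
    (hf : f ∈ Fg K V (F.deg (k + 1)) e) : F.d k f ∈ Rg F k e :=
  ⟨fun j => map_mem_Sg _ (d_single_mem F k j) hf, f, rfl⟩

lemma exists_of_mem_Rg {k : ℕ} {e : ℤ} {m : F.ι k →₀ MvPolynomial V K} (hm : m ∈ Rg F k e) :
    ∃ f ∈ Fg K V (F.deg (k + 1)) e, F.d k f = m := by
  obtain ⟨hm, f, rfl⟩ := hm
  refine ⟨fcomp K V _ e f, fcomp_mem _ _ _, ?_⟩
  ext1 j
  have := comp_map _ (d_single_mem F k j) e f
  rw [LinearMap.comp_apply, LinearMap.comp_apply, Finsupp.lapply_apply, Finsupp.lapply_apply,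
    comp_of_mem (hm j)] at this
  exact this.symm

lemma aug_mem_Ig {e : ℤ} {f : F.ι 0 →₀ MvPolynomial V K} (hf : f ∈ Fg K V (F.deg 0) e) :
    F.aug f ∈ Ig I e := by
  refine ⟨?_, by simpa using map_mem_Sg _ (aug_single_mem F) hf⟩
  have : F.aug f ∈ LinearMap.range F.aug := ⟨f, rfl⟩
  rw [F.range_aug] at this
  exact this

lemma exists_of_mem_Ig {e : ℤ} {m : MvPolynomial V K} (hm : m ∈ Ig I e) :
    ∃ f ∈ Fg K V (F.deg 0) e, F.aug f = m := by
  have h : m ∈ LinearMap.range F.aug := by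
    rw [F.range_aug]
    exact hm.1
  obtain ⟨f, rfl⟩ := h
  refine ⟨fcomp K V _ e f, fcomp_mem _ _ _, ?_⟩
  rw [← comp_map _ (aug_single_mem F), sub_zero, comp_of_mem hm.2]

lemma exists_bdry_eq_Rg (k p : ℕ) (e : ℤ) (hv : Kvan V K (Ig I) (p + k + 1) (e - k - 1))
    {b : Finset V → (F.ι k →₀ MvPolynomial V K)}
    (hb : b ∈ Chain V (Fg K V (F.deg k) (e - 1)) (p + 1))
    (h0 : ∀ σ, bdry (X : V → MvPolynomial V K) b σ ∈ LinearMap.range (F.d k)) :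
    ∃ b' ∈ Chain V (Rg F k (e - 1)) (p + 1),
      bdry (X : V → MvPolynomial V K) b' = bdry (X : V → MvPolynomial V K) b := by
  induction k generalizing p e with
  | zero =>
    obtain ⟨b', hb', h1, h2⟩ := exists_bdry_eq_of_Kvan F.aug (NM := Ig I)
      (X_smul_mem_Fg (d := F.deg 0)) (fun e f hf => aug_mem_Ig F hf)
      (fun e m hm => exists_of_mem_Ig F hm) (by simpa using hv) hb (fun σ => by
        have := h0 σ
        rwa [← F.exact_zero] at this)
    refine ⟨b', ⟨fun σ => ⟨hb'.1 σ, ?_⟩, hb'.2⟩, h2⟩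
    have : b' σ ∈ LinearMap.ker F.aug := h1 σ
    rw [F.exact_zero] at this
    exact this
  | succ k IH =>
    have hR : Kvan V K (Rg F k) (p + 1) (e - 1) := by
      haveI := F.finite k
      intro f hf hf0
      obtain ⟨c, hc, rfl⟩ := Kvan_Fg (d := F.deg k) (Nat.succ_ne_zero p) (e - 1) f
        ⟨fun σ => (hf.1 σ).1, hf.2⟩ hf0
      refine IH (p + 1) (e - 1) ?_ hc fun σ => (hf.1 σ).2
      convert hv using 1
      · ring
      · push_cast
        ring
    obtain ⟨b', hb', h1, h2⟩ := exists_bdry_eq_of_Kvan (F.d k) (NM := Rg F k)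
      (X_smul_mem_Fg (d := F.deg (k + 1))) (fun e f hf => d_mem_Rg F hf)
      (fun e m hm => exists_of_mem_Rg F hm) hR hb (fun σ => by
        have := h0 σ
        rwa [← F.exact k] at this)
    refine ⟨b', ⟨fun σ => ⟨hb'.1 σ, ?_⟩, hb'.2⟩, h2⟩
    have : b' σ ∈ LinearMap.ker (F.d k) := h1 σ
    rw [F.exact k] at this
    exact this

lemma constantCoeff_of_mem_range {F : GradedFreeResolution V K ℕ (fun _ => 1) I} (hF : F.Minimal)
    {k : ℕ} {f : F.ι k →₀ MvPolynomial V K} (hf : f ∈ LinearMap.range (F.d k)) (j : F.ι k) :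
    constantCoeff (f j) = 0 := by
  obtain ⟨g, rfl⟩ := hf
  induction g using Finsupp.induction_linear with
  | zero => simp
  | add f g hf hg => simp only [map_add, Finsupp.add_apply, hf, hg, add_zero]
  | single i s =>
    have : Finsupp.single i s = s • Finsupp.single i (1 : MvPolynomial V K) := by simp
    rw [this, map_smul, Finsupp.smul_apply, smul_eq_mul, map_mul, hF k i j, mul_zero]

lemma sub_bdry_notMem_range {F : GradedFreeResolution V K ℕ (fun _ => 1) I} (hF : F.Minimal)
    {k : ℕ} (i : F.ι k) (b : Finset V → (F.ι k →₀ MvPolynomial V K)) (σ : Finset V)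
    (h : Finsupp.single i 1 - bdry (X : V → MvPolynomial V K) b σ ∈ LinearMap.range (F.d k)) :
    False := by
  have h1 := constantCoeff_of_mem_range hF h i
  have h2 : constantCoeff (bdry (X : V → MvPolynomial V K) b σ i) = 0 := by
    rw [bdry_apply, Finsupp.finsetSum_apply, map_sum]
    refine Finset.sum_eq_zero fun x _ => ?_
    rw [Finsupp.smul_apply, smul_eq_mul, map_mul, constantCoeff_X, zero_mul]
  rw [Finsupp.sub_apply, map_sub, h2, Finsupp.single_eq_same, map_one, sub_zero] at h1
  exact one_ne_zero h1

lemma single_mem_Fg (k : ℕ) (i : F.ι k) :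
    (Finsupp.single i 1 : F.ι k →₀ MvPolynomial V K) ∈ Fg K V (F.deg k) (F.deg k i) := by
  classical
  intro j
  rw [Finsupp.single_apply]
  split_ifs with h
  · subst h
    rw [sub_self]
    exact isWeightedHomogeneous_one K _
  · exact zero_mem _

/-- A minimal resolution has no generators in the degrees where the Koszul homology of the
ideal vanishes. -/
theorem not_Kvan_of_minimal {F : GradedFreeResolution V K ℕ (fun _ => 1) I} (hF : F.Minimal)
    (k : ℕ) (i : F.ι k) (hv : Kvan V K (Ig I) k (F.deg k i - k)) : False := by
  rcases k with _ | k
  · obtain ⟨b, hb, hbf⟩ := hv (Pi.single ∅ (F.aug (Finsupp.single i 1)))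
      (mem_Chain_zero (by simpa using aug_mem_Ig F (single_mem_Fg F 0 i)))
      (bdry_single_empty _ _)
    choose g hg hgb using fun σ => exists_of_mem_Ig F (hb.1 σ)
    refine sub_bdry_notMem_range hF i g ∅ ?_
    rw [← F.exact_zero, LinearMap.mem_ker, map_sub, sub_eq_zero]
    have h1 := congrFun (bdry_map (X : V → MvPolynomial V K) F.aug g) ∅
    simp only [hgb] at h1
    have h2 := congrFun hbf ∅
    rw [Pi.single_eq_same] at h2
    rw [← h1, ← h2]
  · haveI := F.finite k
    have hm : F.d k (Finsupp.single i 1) ∈ Rg F k (F.deg (k + 1) i) :=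
      d_mem_Rg F (single_mem_Fg F (k + 1) i)
    obtain ⟨b, hb, hbf⟩ := Kvan_Fg_aux (mem_Chain_zero hm.1) (bdry_single_empty _ _) (by
      intro j
      by_cases hj : (F.deg (k + 1) i : ℤ) - F.deg k j = 0
      · refine Or.inr (Or.inr fun σ => ?_)
        have h1 := hm.1 j
        have h2 := hF k i j
        rw [hj] at h1
        have h3 : F.d k (Finsupp.single i 1) j = 0 := by
          ext m
          rw [coeff_zero]
          by_contra hne
          have h4 := mem_Sg.mp h1 m hne
          have h5 : m = 0 := by
            ext x
            rw [tdeg_eq] at h4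
            have := (Finset.sum_eq_zero_iff_of_nonneg (fun x _ => by positivity)).mp h4 x
              (Finset.mem_univ x)
            simpa using this
          rw [h5] at hne
          exact hne h2
        by_cases hσ : σ = ∅
        · subst hσ
          rw [Pi.single_eq_same, h3]
        · rw [Pi.single_eq_of_ne hσ]
          rfl
      · exact Or.inr (Or.inl hj))
    have hmem : ∀ σ, bdry (X : V → MvPolynomial V K) b σ ∈ LinearMap.range (F.d k) := by
      intro σ
      rw [hbf]
      by_cases hσ : σ = ∅
      · subst hσ
        rw [Pi.single_eq_same]
        exact hm.2
      · rw [Pi.single_eq_of_ne hσ]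
        exact zero_mem _
    obtain ⟨b', hb', hbb'⟩ := exists_bdry_eq_Rg F k 0 _ (by
      convert hv using 1
      · ring
      · push_cast
        ring) hb hmem
    choose g hg hgb using fun σ => exists_of_mem_Rg F (hb'.1 σ)
    refine sub_bdry_notMem_range hF i g ∅ ?_
    rw [← F.exact k, LinearMap.mem_ker, map_sub, sub_eq_zero]
    have h1 := congrFun (bdry_map (X : V → MvPolynomial V K) (F.d k) g) ∅
    simp only [hgb] at h1
    have h2 := congrFun (hbb'.trans hbf) ∅
    rw [Pi.single_eq_same] at h2
    rw [← h1, ← h2]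

end Resolution


section Vanishing

variable {K : Type} [Field K]

lemma MonSupp.add {V : Type} [Fintype V] [DecidableEq V] {E : Set (V →₀ ℕ)} {α : V →₀ ℕ} {p : ℕ}
    {c c' : Finset V → K} (h : MonSupp E α p c) (h' : MonSupp E α p c') :
    MonSupp E α p (c + c') := by
  intro σ hσ
  by_cases h0 : c σ = 0
  · refine h' σ fun h1 => hσ ?_
    simp [h0, h1]
  · exact h σ h0

lemma MonSupp.neg {V : Type} [Fintype V] [DecidableEq V] {E : Set (V →₀ ℕ)} {α : V →₀ ℕ} {p : ℕ}
    {c : Finset V → K} (h : MonSupp E α p c) : MonSupp E α p (-c) :=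
  fun σ hσ => h σ (by simpa using hσ)

lemma exists_of_bdry_ne_zero {V : Type} [Fintype V] [DecidableEq V] {c : Finset V → K}
    {σ : Finset V} (h : bdry (1 : V → K) c σ ≠ 0) : ∃ x ∉ σ, c (insert x σ) ≠ 0 := by
  rw [bdry_apply] at h
  obtain ⟨x, -, hx⟩ := Finset.exists_ne_zero_of_sum_ne_zero h
  by_cases hxσ : x ∈ σ
  · simp [hxσ] at hx
  · simp only [hxσ, if_false, Pi.one_apply, one_smul] at hx
    exact ⟨x, hxσ, right_ne_zero_of_smul hx⟩

lemma MonSupp.bdry {V : Type} [Fintype V] [DecidableEq V] {E : Set (V →₀ ℕ)} (hE : IsUpperSet E)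
    {α : V →₀ ℕ} {p : ℕ} {c : Finset V → K} (h : MonSupp E α (p + 1) c) :
    MonSupp E α p (CSReg.bdry (1 : V → K) c) := by
  intro σ hσ
  obtain ⟨x, hx, hc⟩ := exists_of_bdry_ne_zero hσ
  obtain ⟨h1, h2, h3⟩ := h _ hc
  rw [Finset.card_insert_of_notMem hx] at h1
  have h4 : ind σ ≤ ind (insert x σ) := by
    rw [ind_insert hx]
    simp
  exact ⟨by omega, h4.trans h2, hE (tsub_le_tsub_left h4 _) h3⟩

variable {v : ℕ} {n : Fin v → ℕ}

/-- Closure under moving a whole power of a variable to an earlier variable of its row. -/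
def Movable (E : Set (MVar v n →₀ ℕ)) : Prop :=
  ∀ m ∈ E, ∀ (i : Fin v) (j k : Fin (n i + 1)), k < j →
    m.erase ⟨i, j⟩ + Finsupp.single ⟨i, k⟩ (m ⟨i, j⟩) ∈ E

/-- Some variable of row `i` divides `α - ind σ` and either it is not the last variable of the
row dividing `α`, or its square divides `α`. -/
def RowSpare (α : MVar v n →₀ ℕ) (i : Fin v) (σ : Finset (MVar v n)) : Prop :=
  ∃ j : Fin (n i + 1), ((∃ j', j < j' ∧ α ⟨i, j'⟩ ≠ 0) ∧ ind σ ⟨i, j⟩ < α ⟨i, j⟩) ∨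
    ((∀ j', j < j' → α ⟨i, j'⟩ = 0) ∧ 2 ≤ α ⟨i, j⟩)

lemma RowSpare.congr {α : MVar v n →₀ ℕ} {i : Fin v} {σ σ' : Finset (MVar v n)}
    (h : RowSpare α i σ) (hσ : ∀ j, ind σ' ⟨i, j⟩ ≤ ind σ ⟨i, j⟩) : RowSpare α i σ' := by
  obtain ⟨j, ⟨h1, h2⟩ | h1⟩ := h
  · exact ⟨j, Or.inl ⟨h1, (hσ j).trans_lt h2⟩⟩
  · exact ⟨j, Or.inr h1⟩

lemma exists_rowSpare {α : MVar v n →₀ ℕ} {σ : Finset (MVar v n)}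
    (h : (v : ℤ) < tdeg (α - ind σ)) : ∃ i, RowSpare α i σ := by
  by_contra! hcon
  refine h.not_ge ?_
  rw [tdeg_eq, Fintype.sum_sigma]
  calc _ ≤ ∑ _i : Fin v, (1 : ℤ) := Finset.sum_le_sum fun i _ => ?_
    _ = v := by simp
  by_cases hz : ∃ j, α ⟨i, j⟩ ≠ 0
  · obtain ⟨z, hz, hzmax⟩ := (Finset.univ.filter fun j => α ⟨i, j⟩ ≠ 0).exists_max_image id
      (by obtain ⟨j, hj⟩ := hz; exact ⟨j, by simpa using hj⟩)
    simp only [Finset.mem_filter, Finset.mem_univ, true_and, id] at hz hzmax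
    have hmax : ∀ j', z < j' → α ⟨i, j'⟩ = 0 := fun j' hj' => by
      by_contra h0
      exact absurd (hzmax j' h0) (not_le.mpr hj')
    rw [Finset.sum_eq_single z]
    · have : ¬ 2 ≤ α ⟨i, z⟩ := fun h2 => hcon i ⟨z, Or.inr ⟨hmax, h2⟩⟩
      rw [Finsupp.tsub_apply]
      omega
    · intro j _ hj
      rcases lt_or_gt_of_ne hj with h1 | h1
      · have : ¬ ind σ ⟨i, j⟩ < α ⟨i, j⟩ := fun h2 => hcon i ⟨j, Or.inl ⟨⟨z, h1, hz⟩, h2⟩⟩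
        rw [Finsupp.tsub_apply]
        omega
      · rw [Finsupp.tsub_apply, hmax j h1]
        simp
    · simp
  · push Not at hz
    rw [Finset.sum_eq_zero]
    · exact zero_le_one
    · intro j _
      rw [Finsupp.tsub_apply, hz j]
      simp

lemma sub_ind_insert_mem {E : Set (MVar v n →₀ ℕ)} (hW : Movable E)
    (hsq : ∀ m ∈ E, ∀ m' : MVar v n →₀ ℕ, m.support ⊆ m'.support → m' ∈ E)
    {α : MVar v n →₀ ℕ} {i : Fin v} {z : Fin (n i + 1)} {σ : Finset (MVar v n)} (hz : α ⟨i, z⟩ ≠ 0)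
    (hmax : ∀ j', z < j' → α ⟨i, j'⟩ = 0) (hzσ : (⟨i, z⟩ : MVar v n) ∉ σ)
    (hR : RowSpare α i σ) (hE : α - ind σ ∈ E) : α - ind (insert ⟨i, z⟩ σ) ∈ E := by
  by_cases h2 : 2 ≤ α ⟨i, z⟩
  · refine hsq _ hE _ fun y hy => ?_
    rw [Finsupp.mem_support_iff, Finsupp.tsub_apply] at hy ⊢
    rw [ind_insert hzσ, Finsupp.add_apply, Finsupp.single_apply]
    split_ifs with h
    · subst h
      have : ind σ ⟨i, z⟩ = 0 := by simp [ind_apply, hzσ]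
      omega
    · simpa using hy
  · obtain ⟨j, ⟨⟨j', hj', hj0⟩, hj⟩ | ⟨h1, h3⟩⟩ := hR
    · have hjz : j < z := by
        refine hj'.trans_le ?_
        by_contra hc
        exact hj0 (hmax _ (not_le.mp hc))
      refine hsq _ (hW _ hE i z j hjz) _ fun y hy => ?_
      rw [Finsupp.mem_support_iff, Finsupp.add_apply, Finsupp.erase_apply,
        Finsupp.single_apply] at hy
      rw [Finsupp.mem_support_iff, Finsupp.tsub_apply, ind_insert hzσ, Finsupp.add_apply,
        Finsupp.single_apply]
      by_cases hyj : (⟨i, j⟩ : MVar v n) = y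
      · subst hyj
        have : (⟨i, z⟩ : MVar v n) ≠ ⟨i, j⟩ := by
          simp only [ne_eq, Sigma.mk.injEq, heq_eq_eq, true_and]
          exact hjz.ne'
        rw [if_neg this]
        omega
      · rw [if_neg hyj, add_zero] at hy
        split_ifs at hy with h
        · exact absurd rfl hy
        · rw [if_neg (Ne.symm h)]
          simpa using hy
    · exfalso
      rcases lt_trichotomy j z with h | h | h
      · exact hz (h1 z h)
      · subst h
        exact h2 h3
      · have := hmax j h
        omega

lemma MonVan_aux {E : Set (MVar v n →₀ ℕ)} (hU : IsUpperSet E) (hW : Movable E)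
    (hsq : ∀ m ∈ E, ∀ m' : MVar v n →₀ ℕ, m.support ⊆ m'.support → m' ∈ E)
    {α : MVar v n →₀ ℕ} {p : ℕ} (k : ℕ) (c : Finset (MVar v n) → K) (hc : MonSupp E α p c)
    (hc0 : bdry (1 : MVar v n → K) c = 0)
    (hk : ∀ σ, c σ ≠ 0 → ∃ i : Fin v, i.val < k ∧ RowSpare α i σ) :
    ∃ b, MonSupp E α (p + 1) b ∧ bdry (1 : MVar v n → K) b = c := by
  classical
  induction k generalizing c with
  | zero =>
    refine ⟨0, fun σ hσ => absurd rfl hσ, ?_⟩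
    rw [map_zero]
    ext1 σ
    by_contra hne
    obtain ⟨i, hi, -⟩ := hk σ (Ne.symm hne)
    omega
  | succ k IH =>
    by_cases hskip : ∀ σ, c σ ≠ 0 → ∃ i : Fin v, i.val < k ∧ RowSpare α i σ
    · exact IH c hc hc0 hskip
    obtain ⟨σ₀, hσ₀, hnot⟩ : ∃ σ, c σ ≠ 0 ∧ ¬ ∃ i : Fin v, i.val < k ∧ RowSpare α i σ := by
      simpa using hskip
    obtain ⟨i, hi, hRi⟩ := hk σ₀ hσ₀
    have hik : i.val = k := by
      by_contra hne
      exact hnot ⟨i, by omega, hRi⟩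
    have hne : ∃ j, α ⟨i, j⟩ ≠ 0 := by
      obtain ⟨j, ⟨h1, h2⟩ | ⟨h1, h2⟩⟩ := hRi
      · exact ⟨j, by omega⟩
      · exact ⟨j, by omega⟩
    obtain ⟨z, hz, hzmax⟩ := (Finset.univ.filter fun j => α ⟨i, j⟩ ≠ 0).exists_max_image id
      (by obtain ⟨j, hj⟩ := hne; exact ⟨j, by simpa using hj⟩)
    simp only [Finset.mem_filter, Finset.mem_univ, true_and, id] at hz hzmax
    have hmax : ∀ j', z < j' → α ⟨i, j'⟩ = 0 := fun j' hj' => by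
      by_contra h0
      exact absurd (hzmax j' h0) (not_le.mpr hj')
    set Q : Finset (MVar v n) → Prop := fun σ => ∃ i : Fin v, i.val < k ∧ RowSpare α i σ with hQ
    set c₁ : Finset (MVar v n) → K := fun σ => if Q σ then 0 else c σ with hc₁
    set c₂ : Finset (MVar v n) → K := fun σ => if Q σ then c σ else 0 with hc₂
    have hcc : c = c₁ + c₂ := by
      ext σ
      simp only [hc₁, hc₂, Pi.add_apply]
      split_ifs <;> simp
    set h := wedge K (⟨i, z⟩ : MVar v n) c₁ with hh
    have hbh : c - bdry (1 : MVar v n → K) h = c₂ - wedge K ⟨i, z⟩ (bdry (1 : MVar v n → K) c₂) := by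
      have h1 : bdry (1 : MVar v n → K) c₁ = - bdry (1 : MVar v n → K) c₂ := by
        rw [hcc, map_add] at hc0
        exact eq_neg_of_add_eq_zero_left hc0
      rw [hh, bdry_wedge, h1, map_neg, Pi.one_apply, one_smul]
      nth_rewrite 1 [hcc]
      abel
    have hhs : MonSupp E α (p + 1) h := by
      intro σ hσ
      rw [hh, wedge_apply] at hσ
      split_ifs at hσ with hzσ
      · have h1 := right_ne_zero_of_smul hσ
        simp only [hc₁] at h1
        split_ifs at h1 with hq
        · exact absurd rfl h1
        · obtain ⟨h2, h3, h4⟩ := hc _ h1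
          obtain ⟨i', hi', hRi'⟩ := hk _ h1
          have : i' = i := by
            by_contra hii
            refine hq ⟨i', ?_, hRi'⟩
            have : i'.val ≠ i.val := fun h => hii (Fin.ext h)
            omega
          subst this
          have hzn : (⟨i', z⟩ : MVar v n) ∉ σ.erase ⟨i', z⟩ := by simp
          have h5 := sub_ind_insert_mem hW hsq hz hmax hzn hRi' h4
          rw [Finset.insert_erase hzσ] at h5
          refine ⟨by rw [← h2, Finset.card_erase_add_one hzσ], fun y => ?_, h5⟩
          rw [← Finset.insert_erase hzσ, ind_insert hzn, Finsupp.add_apply, Finsupp.single_apply]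
          split_ifs with hy
          · subst hy
            have : ind (σ.erase ⟨i', z⟩) ⟨i', z⟩ = 0 := by simp [ind_apply]
            omega
          · exact h3 y
      · exact absurd rfl hσ
    obtain ⟨b, hb, hbb⟩ := IH (c - bdry (1 : MVar v n → K) h)
      (by rw [sub_eq_add_neg]; exact hc.add (hhs.bdry hU).neg)
      (by rw [map_sub, hc0, bdry_bdry, sub_zero]) (by
        intro σ hσ
        rw [hbh, Pi.sub_apply] at hσ
        by_cases h2 : c₂ σ = 0
        · rw [h2, zero_sub, neg_ne_zero, wedge_apply] at hσ
          split_ifs at hσ with hzσ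
          · obtain ⟨x, hx, hcx⟩ := exists_of_bdry_ne_zero (right_ne_zero_of_smul hσ)
            simp only [hc₂] at hcx
            split_ifs at hcx with hq
            · obtain ⟨i', hi', hRi'⟩ := hq
              refine ⟨i', hi', hRi'.congr fun j => ?_⟩
              have hji : (⟨i', j⟩ : MVar v n) ≠ ⟨i, z⟩ := by
                intro heq
                have := congrArg Sigma.fst heq
                simp only at this
                subst this
                omega
              rw [ind_insert hx, Finsupp.add_apply]
              simp [ind_apply, hji]
            · exact absurd rfl hcx
          · exact absurd rfl hσ
        · simp only [hc₂] at h2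
          split_ifs at h2 with hq
          · exact hq
          · exact absurd rfl h2)
    exact ⟨b + h, hb.add hhs, by rw [map_add, hbb, sub_add_cancel]⟩

theorem MonVan_of_movable {E : Set (MVar v n →₀ ℕ)} (hU : IsUpperSet E) (hW : Movable E)
    (hsq : ∀ m ∈ E, ∀ m' : MVar v n →₀ ℕ, m.support ⊆ m'.support → m' ∈ E)
    {p : ℕ} {e : ℤ} (he : (v : ℤ) < e) : MonVan K E p e := by
  intro α hα c hc hc0
  refine MonVan_aux hU hW hsq v c hc hc0 fun σ hσ => ?_
  obtain ⟨h1, h2, -⟩ := hc σ hσ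
  have h3 := congrArg tdeg (tsub_add_cancel_of_le h2)
  rw [map_add, hα, tdeg_ind, h1] at h3
  obtain ⟨i, hi⟩ := exists_rowSpare (σ := σ) (by linarith)
  exact ⟨i, i.2, hi⟩

end Vanishing


section Monomial

variable {V : Type} [Fintype V] [DecidableEq V] {K : Type} [Field K]

lemma monomial_mem_of_torus [Infinite K] {J : Ideal (MvPolynomial V K)}
    (hJ : ∀ l : V → K, (∀ x, l x ≠ 0) → ∀ f ∈ J, aeval (fun x => C (l x) * X x) f ∈ J)
    {f : MvPolynomial V K} (hf : f ∈ J) {m : V →₀ ℕ} (hm : coeff m f ≠ 0) :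
    monomial m (1 : K) ∈ J := by
  by_contra hcon
  obtain ⟨ℓ, hℓ, hker⟩ := Submodule.exists_le_ker_of_notMem
    (p := J.restrictScalars K) (v := monomial m (1 : K)) hcon
  set P : MvPolynomial V K :=
    ∑ d ∈ f.support, monomial d (coeff d f * ℓ (monomial d 1)) with hP
  have hev : ∀ l : V → K, (∀ x, l x ≠ 0) → eval l P = 0 := by
    intro l hl
    have h1 : ℓ (aeval (fun x => C (l x) * X x) f) = 0 := hker (hJ l hl f hf)
    rw [← h1, hP]
    conv_rhs => rw [f.as_sum]
    rw [map_sum, map_sum, map_sum]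
    refine Finset.sum_congr rfl fun d _ => ?_
    rw [eval_monomial, aeval_monomial]
    have : (algebraMap K (MvPolynomial V K) (coeff d f) *
        d.prod fun i k => (C (l i) * X i : MvPolynomial V K) ^ k) =
        (coeff d f * d.prod fun i k => l i ^ k) • monomial d (1 : K) := by
      rw [smul_monomial, smul_eq_mul, mul_one, monomial_eq, C_mul, Finsupp.prod, Finsupp.prod,
        Finsupp.prod, map_prod, mul_assoc, ← Finset.prod_mul_distrib, MvPolynomial.algebraMap_eq]
      simp only [mul_pow, map_pow]
    rw [this, map_smul, smul_eq_mul]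
    ring
  have h0 : P * ∏ x, X x = 0 := by
    refine MvPolynomial.funext fun l => ?_
    rw [map_mul, map_zero, map_prod]
    simp only [eval_X]
    by_cases hl : ∀ x, l x ≠ 0
    · rw [hev l hl, zero_mul]
    · push Not at hl
      obtain ⟨x, hx⟩ := hl
      rw [Finset.prod_eq_zero (Finset.mem_univ x) hx, mul_zero]
  have hP0 : P = 0 := by
    refine (mul_eq_zero.mp h0).resolve_right ?_
    exact Finset.prod_ne_zero_iff.mpr fun x _ => X_ne_zero x
  have hc : coeff m P = coeff m f * ℓ (monomial m 1) := by
    rw [hP, coeff_sum, Finset.sum_eq_single m]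
    · rw [coeff_monomial, if_pos rfl]
    · intro d _ hd
      rw [coeff_monomial, if_neg hd]
    · intro h
      rw [coeff_monomial, if_pos rfl, notMem_support_iff.mp h, zero_mul]
  rw [hP0, coeff_zero] at hc
  exact mul_ne_zero hm hℓ hc.symm

lemma trans_monomial (x w : V) (c : K) (m : V →₀ ℕ) :
    trans x w c (monomial m 1) =
      monomial (m.erase x) 1 * (X x + C c * X w) ^ m x := by
  conv_lhs => rw [← Finsupp.erase_add_single x m]
  rw [← one_mul (1 : K), ← monomial_mul, map_mul, one_mul]
  congr 1
  · rw [trans, aeval_monomial, monomial_eq]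
    simp only [map_one, one_mul]
    refine Finsupp.prod_congr fun y hy => ?_
    rw [Finsupp.support_erase, Finset.mem_erase] at hy
    rw [if_neg hy.1, add_zero]
  · rw [← X_pow_eq_monomial, map_pow, trans_X, if_pos rfl]

lemma coeff_trans_monomial {x w : V} (hxw : x ≠ w) (c : K) (m : V →₀ ℕ) :
    coeff (m.erase x + Finsupp.single w (m x)) (trans x w c (monomial m 1)) = c ^ m x := by
  rw [trans_monomial x w c m, coeff_monomial_mul, one_mul]
  obtain ⟨r, hr⟩ := sub_dvd_pow_sub_pow (X x + C c * X w : MvPolynomial V K) (C c * X w) (m x)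
  rw [sub_eq_iff_eq_add, add_sub_cancel_right] at hr
  rw [hr, coeff_add, coeff_X_mul', if_neg, zero_add, mul_pow, ← C_pow, coeff_C_mul, coeff_X_pow,
    if_pos rfl, mul_one]
  simp [hxw.symm]

lemma coeff_trans_monomial_self {x w : V} (hxw : x ≠ w) (c : K) (m : V →₀ ℕ) :
    coeff m (trans x w c (monomial m 1)) = 1 := by
  rw [trans_monomial x w c m]
  suffices h : coeff (m.erase x + Finsupp.single x (m x))
      (monomial (m.erase x) 1 * (X x + C c * X w) ^ m x) = 1 by
    rwa [Finsupp.erase_add_single] at h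
  rw [coeff_monomial_mul, one_mul]
  obtain ⟨r, hr⟩ := sub_dvd_pow_sub_pow (X x + C c * X w : MvPolynomial V K) (X x) (m x)
  rw [sub_eq_iff_eq_add, add_sub_cancel_left] at hr
  rw [hr, coeff_add, mul_assoc, coeff_C_mul, coeff_X_mul', if_neg, mul_zero, zero_add, coeff_X_pow,
    if_pos rfl]
  simp [hxw]

lemma le_of_coeff_trans_ne_zero (τ : MonomialOrder V) {x w : V}
    (h : τ.toSyn (Finsupp.single x 1) ≤ τ.toSyn (Finsupp.single w 1)) (c : K) {f : MvPolynomial V K}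
    {d : V →₀ ℕ} (hd : coeff d (trans x w c f) ≠ 0) :
    ∃ m, coeff m f ≠ 0 ∧ τ.toSyn m ≤ τ.toSyn d := by
  have key : ∀ m : V →₀ ℕ, ∀ d, coeff d (trans x w c (monomial m 1)) ≠ 0 →
      τ.toSyn m ≤ τ.toSyn d := by
    intro m
    induction m using Finsupp.induction_linear with
    | zero =>
      intro d _
      rw [map_zero]
      exact bot_le
    | add a b ha hb =>
      intro d hd
      rw [← one_mul (1 : K), ← monomial_mul, map_mul, coeff_mul] at hd
      obtain ⟨⟨p, q⟩, hpq, hne⟩ := Finset.exists_ne_zero_of_sum_ne_zero hd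
      rw [Finset.HasAntidiagonal.mem_antidiagonal] at hpq
      rw [← hpq, map_add, map_add]
      exact add_le_add (ha _ (left_ne_zero_of_mul hne)) (hb _ (right_ne_zero_of_mul hne))
    | single y k =>
      induction k with
      | zero =>
        intro d _
        rw [Finsupp.single_zero, map_zero]
        exact bot_le
      | succ k ih =>
        intro d hd
        rw [Finsupp.single_add, ← one_mul (1 : K), ← monomial_mul, map_mul, coeff_mul] at hd
        obtain ⟨⟨p, q⟩, hpq, hne⟩ := Finset.exists_ne_zero_of_sum_ne_zero hd
        rw [Finset.HasAntidiagonal.mem_antidiagonal] at hpq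
        rw [← hpq, Finsupp.single_add, map_add, map_add]
        refine add_le_add (ih _ (left_ne_zero_of_mul hne)) ?_
        have hq := right_ne_zero_of_mul hne
        change coeff q (trans x w c (X y)) ≠ 0 at hq
        rw [trans_X, coeff_add, coeff_X] at hq
        by_cases hqy : Finsupp.single y 1 = q
        · rw [hqy]
        · rw [if_neg hqy, zero_add] at hq
          split_ifs at hq with hyx
          · rw [coeff_C_mul, coeff_X] at hq
            have h2 := right_ne_zero_of_mul hq
            split_ifs at h2 with h3
            · rw [← h3, hyx]
              exact h
            · exact absurd rfl h2
          · simp at hq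
  rw [f.as_sum, map_sum, coeff_sum] at hd
  obtain ⟨m, hm, hne⟩ := Finset.exists_ne_zero_of_sum_ne_zero hd
  rw [← mul_one (coeff m f), ← smul_eq_mul, ← smul_monomial, map_smul, coeff_smul] at hne
  exact ⟨m, mem_support_iff.mp hm, key m d (right_ne_zero_of_smul hne)⟩

/-- The set of exponents of leading monomials computes the dimension of a space of polynomials. -/
lemma finrank_eq_ncard_degree (τ : MonomialOrder V) {W : Submodule K (MvPolynomial V K)}
    {L : Set (V →₀ ℕ)} (hL : L.Finite)
    (h : ∀ m, m ∈ L ↔ ∃ f ∈ W, f ≠ 0 ∧ τ.degree f = m) :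
    FiniteDimensional K W ∧ Module.finrank K W = L.ncard := by
  classical
  haveI := hL.fintype
  let ev : W →ₗ[K] (L → K) := LinearMap.pi fun m => (lcoeff K m.1).comp W.subtype
  have hev : Function.Injective ev := by
    rw [← LinearMap.ker_eq_bot, LinearMap.ker_eq_bot']
    rintro ⟨f, hf⟩ h0
    by_contra hne
    have hf0 : f ≠ 0 := fun h1 => hne (Subtype.ext h1)
    have := congr_fun h0 ⟨τ.degree f, (h _).mpr ⟨f, hf, hf0, rfl⟩⟩
    exact τ.leadingCoeff_ne_zero_iff.mpr hf0 this
  have hfin : FiniteDimensional K W := Module.Finite.of_injective ev hev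
  refine ⟨hfin, le_antisymm ?_ ?_⟩
  · refine (LinearMap.finrank_le_finrank_of_injective hev).trans ?_
    rw [Module.finrank_fintype_fun_eq_card, ← Nat.card_eq_fintype_card]
    rfl
  · choose g hgW hg0 hg using fun m : L => (h m.1).mp m.2
    have hli : LinearIndependent K (fun m : L => (⟨g m, hgW m⟩ : W)) := by
      rw [Fintype.linearIndependent_iff]
      intro c hc
      by_contra! hne
      obtain ⟨m0, hm0⟩ := hne
      obtain ⟨m1, hm1, hmax⟩ := (Finset.univ.filter fun m => c m ≠ 0).exists_max_image
        (fun m => τ.toSyn m.1) ⟨m0, by simpa using hm0⟩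
      simp only [Finset.mem_filter, Finset.mem_univ, true_and] at hm1 hmax
      have h1 := congr_arg (fun f : W => coeff m1.1 f.1) hc
      simp only [AddSubmonoidClass.coe_finsetSum, SetLike.val_smul, coeff_sum, coeff_smul,
        ZeroMemClass.coe_zero, coeff_zero] at h1
      rw [Finset.sum_eq_single m1] at h1
      · refine smul_ne_zero hm1 ?_ h1
        have := τ.leadingCoeff_ne_zero_iff.mpr (hg0 m1)
        rwa [MonomialOrder.leadingCoeff, hg] at this
      · intro m _ hm
        by_cases hcm : c m = 0
        · rw [hcm, zero_smul]
        · rw [τ.coeff_eq_zero_of_lt, smul_zero]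
          rw [hg]
          refine lt_of_le_of_ne (hmax m hcm) fun h2 => hm (Subtype.ext (τ.toSyn.injective h2))
      · simp
    have := hli.fintype_card_le_finrank
    rwa [← Nat.card_eq_fintype_card] at this

end Monomial

section Graded

variable {K : Type} [Field K] {v : ℕ} {n : Fin v → ℕ}

/-- The multidegree of a monomial. -/
def mdeg (m : MVar v n →₀ ℕ) : Fin v → ℕ := Finsupp.weight (wt v n) m

lemma mdeg_add (m m' : MVar v n →₀ ℕ) : mdeg (m + m') = mdeg m + mdeg m' := map_add _ _ _

lemma mdeg_single (x : MVar v n) (k : ℕ) : mdeg (Finsupp.single x k) = Pi.single x.1 k := by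
  rw [mdeg, Finsupp.weight_single, wt, ← Pi.single_smul]
  simp

lemma mdeg_apply (m : MVar v n →₀ ℕ) (i : Fin v) : mdeg m i = ∑ j, m ⟨i, j⟩ := by
  rw [mdeg, Finsupp.weight_eq_sum, Finset.sum_apply, Fintype.sum_sigma, Finset.sum_eq_single i]
  · simp [wt]
  · intro b _ hb
    refine Finset.sum_eq_zero fun j _ => ?_
    simp [wt, hb.symm]
  · simp

lemma tdeg_eq_sum_mdeg (m : MVar v n →₀ ℕ) : tdeg m = ∑ i, (mdeg m i : ℤ) := by
  simp only [tdeg_eq, mdeg_apply, Nat.cast_sum, Fintype.sum_sigma]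

lemma finite_mdeg (a : Fin v → ℕ) : {m : MVar v n →₀ ℕ | mdeg m = a}.Finite := by
  refine (Set.finite_Iic (Finsupp.equivFunOnFinite.symm fun x : MVar v n => a x.1)).subset ?_
  rintro m rfl ⟨i, j⟩
  simp only [Finsupp.equivFunOnFinite_symm_apply_apply, mdeg_apply]
  exact Finset.single_le_sum (f := fun j => m ⟨i, j⟩) (fun _ _ => Nat.zero_le _) (Finset.mem_univ j)

/-- The Hilbert function of a set of monomials. -/
def hcount (E : Set (MVar v n →₀ ℕ)) (a : Fin v → ℕ) : ℕ := {m ∈ E | mdeg m = a}.ncard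

lemma hilb_eq_hcount_lead (τ : MonomialOrder (MVar v n)) {I : Ideal (MvPolynomial (MVar v n) K)}
    (hI : IsMultigraded I) (a : Fin v → ℕ) : hilb I a = hcount (lead τ I) a := by
  refine (finrank_eq_ncard_degree τ ((finite_mdeg a).subset fun m hm => hm.2) fun m => ?_).2
  constructor
  · rintro ⟨hm, rfl⟩
    obtain ⟨f, hf, hfh, hc, hmax⟩ := exists_monic_of_mem_lead (wt v n) hI hm
    have hf0 : f ≠ 0 := by rintro rfl; simp at hc
    refine ⟨f, ⟨hf, hfh⟩, hf0, τ.toSyn.injective (le_antisymm ?_ (τ.le_degree ?_))⟩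
    · exact hmax _ (τ.leadingCoeff_ne_zero_iff.mpr hf0)
    · rw [mem_support_iff, hc]
      exact one_ne_zero
  · rintro ⟨f, ⟨hf, hfh⟩, hf0, rfl⟩
    exact ⟨⟨f, hf, hf0, rfl⟩, hfh (τ.leadingCoeff_ne_zero_iff.mpr hf0)⟩

lemma lead_monIdeal (τ : MonomialOrder (MVar v n)) {E : Set (MVar v n →₀ ℕ)} (hE : IsUpperSet E) :
    lead τ (monIdeal K E) = E := by
  ext m
  constructor
  · rintro ⟨f, hf, hf0, rfl⟩
    exact (mem_monIdeal hE).mp hf _ (τ.leadingCoeff_ne_zero_iff.mpr hf0)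
  · intro hm
    refine mem_lead_of_max (f := monomial m 1) ?_ (m := m) (by simp) ?_
    · refine (mem_monIdeal hE).mpr fun m' hm' => ?_
      rw [coeff_monomial] at hm'
      split_ifs at hm' with h
      · exact h ▸ hm
      · exact absurd rfl hm'
    · intro m' hm'
      rw [coeff_monomial] at hm'
      split_ifs at hm' with h
      · rw [h]
      · exact absurd rfl hm'

lemma isUpperSet_lead {V : Type} [Fintype V] [DecidableEq V] (τ : MonomialOrder V)
    (I : Ideal (MvPolynomial V K)) :
    IsUpperSet (lead τ I) := by
  rintro m m' hle ⟨f, hf, hf0, rfl⟩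
  refine ⟨monomial (m' - τ.degree f) 1 * f, I.mul_mem_left _ hf, ?_, ?_⟩
  · exact mul_ne_zero (by simp) hf0
  · classical
    rw [τ.degree_mul (by simp) hf0, τ.degree_monomial, if_neg one_ne_zero, tsub_add_cancel_of_le hle]

/-- The exponents of the monomials of an ideal. -/
def expSet (J : Ideal (MvPolynomial (MVar v n) K)) : Set (MVar v n →₀ ℕ) :=
  {m | monomial m (1 : K) ∈ J}

lemma isUpperSet_expSet (J : Ideal (MvPolynomial (MVar v n) K)) : IsUpperSet (expSet J) := by
  intro m m' hle hm
  have := J.mul_mem_left (monomial (m' - m) 1) hm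
  rwa [monomial_mul, one_mul, tsub_add_cancel_of_le hle] at this

lemma gAct_diagonal (l : MVar v n → K) :
    gAct (fun i => Matrix.diagonal fun j => l ⟨i, j⟩) =
      aeval fun x : MVar v n => (C (l x) * X x : MvPolynomial (MVar v n) K) := by
  rw [gAct]
  congr 1
  funext ⟨i, j⟩
  rw [Finset.sum_eq_single j]
  · simp
  · intro k _ hk
    simp [Matrix.diagonal_apply_ne _ hk]
  · simp

lemma gAct_transvection (i : Fin v) {j k : Fin (n i + 1)} (h : k ≠ j) :
    gAct (fun i' => if h : i = i' then h ▸ Matrix.transvection k j (1 : K) else 1) =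
      trans (⟨i, j⟩ : MVar v n) ⟨i, k⟩ (1 : K) := by
  rw [gAct, trans]
  congr 1
  funext ⟨i', j'⟩
  by_cases hi : i = i'
  · subst hi
    simp only [dite_true, Matrix.transvection, Matrix.add_apply, map_add, add_mul,
      Finset.sum_add_distrib]
    congr 1
    · rw [Finset.sum_eq_single j']
      · simp
      · intro b _ hb
        simp [Matrix.one_apply_ne hb]
      · simp
    · by_cases hj : j' = j
      · subst hj
        rw [if_pos rfl, Finset.sum_eq_single k]
        · simp
        · intro b _ hb
          simp [hb.symm]
        · simp
      · rw [if_neg (by simpa using hj)]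
        refine Finset.sum_eq_zero fun b _ => ?_
        simp [Ne.symm hj]
  · have : (⟨i', j'⟩ : MVar v n) ≠ ⟨i, j⟩ := fun h0 => hi (congr_arg Sigma.fst h0).symm
    simp only [dif_neg hi, if_neg this, add_zero]
    rw [Finset.sum_eq_single j']
    · simp
    · intro b _ hb
      simp [Matrix.one_apply_ne hb]
    · simp

section BorelFixed

variable {J : Ideal (MvPolynomial (MVar v n) K)}

lemma BorelFixed.gAct_mem (hB : BorelFixed J) {g : ∀ i : Fin v, Matrix (Fin (n i + 1)) (Fin (n i + 1)) K}
    (h1 : ∀ i, IsUnit (g i).det) (h2 : ∀ (i : Fin v) (k j : Fin (n i + 1)), j < k → g i k j = 0)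
    {f : MvPolynomial (MVar v n) K} (hf : f ∈ J) : gAct g f ∈ J := by
  have := Ideal.mem_map_of_mem (gAct g) hf
  rwa [hB g h1 h2] at this

lemma BorelFixed.monomial_mem [Infinite K] (hB : BorelFixed J) {f : MvPolynomial (MVar v n) K} (hf : f ∈ J)
    {m : MVar v n →₀ ℕ} (hm : coeff m f ≠ 0) : m ∈ expSet J := by
  refine monomial_mem_of_torus (fun l hl f hf => ?_) hf hm
  rw [← gAct_diagonal]
  refine BorelFixed.gAct_mem hB (fun i => ?_) (fun i k j hjk => ?_) hf
  · rw [Matrix.det_diagonal, isUnit_iff_ne_zero]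
    exact Finset.prod_ne_zero_iff.mpr fun _ _ => hl _
  · exact Matrix.diagonal_apply_ne _ hjk.ne'

lemma BorelFixed.eq_monIdeal [Infinite K] (hB : BorelFixed J) : J = monIdeal K (expSet J) := by
  ext f
  rw [mem_monIdeal (isUpperSet_expSet J)]
  refine ⟨fun hf m hm => BorelFixed.monomial_mem hB hf hm, fun h => ?_⟩
  rw [f.as_sum]
  refine J.sum_mem fun m hm => ?_
  have := J.mul_mem_left (C (coeff m f)) (h m (mem_support_iff.mp hm))
  rwa [C_mul_monomial, mul_one] at this

lemma BorelFixed.movable [Infinite K] (hB : BorelFixed J) : Movable (expSet J) := by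
  intro m hm i j k hkj
  have hne : (⟨i, j⟩ : MVar v n) ≠ ⟨i, k⟩ := by
    simp only [ne_eq, Sigma.mk.injEq, heq_eq_eq, true_and]
    exact hkj.ne'
  refine BorelFixed.monomial_mem hB (f := trans ⟨i, j⟩ ⟨i, k⟩ 1 (monomial m 1)) ?_ ?_
  · rw [← gAct_transvection i hkj.ne]
    refine BorelFixed.gAct_mem hB (fun i' => ?_) (fun i' k' j' h => ?_) hm
    · by_cases hi : i = i'
      · subst hi
        simp [Matrix.det_transvection_of_ne _ _ hkj.ne]
      · simp [hi]
    · by_cases hi : i = i'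
      · subst hi
        have : ¬ (k = k' ∧ j = j') := by
          rintro ⟨rfl, rfl⟩
          exact lt_asymm h hkj
        simp [Matrix.transvection, this, Matrix.one_apply_ne h.ne']
      · simp [hi, Matrix.one_apply_ne h.ne']
  · rw [coeff_trans_monomial hne]
    simp

end BorelFixed

lemma expSet_mem_of_support_subset {J : Ideal (MvPolynomial (MVar v n) K)} (hJ : J.IsRadical) :
    ∀ m ∈ expSet J, ∀ m' : MVar v n →₀ ℕ, m.support ⊆ m'.support → m' ∈ expSet J := by
  intro m hm m' hs
  refine hJ ⟨∑ x, m x, ?_⟩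
  rw [monomial_pow, one_pow]
  refine isUpperSet_expSet J (fun x => ?_) hm
  by_cases hx : m x = 0
  · rw [hx]
    exact Nat.zero_le _
  · have : m' x ≠ 0 := Finsupp.mem_support_iff.mp (hs (Finsupp.mem_support_iff.mpr hx))
    rw [Finsupp.smul_apply, smul_eq_mul]
    refine le_trans ?_ (Nat.le_mul_of_pos_right _ (Nat.pos_of_ne_zero this))
    exact Finset.single_le_sum (f := fun x => m x) (fun _ _ => Nat.zero_le _) (Finset.mem_univ x)

end Graded


section HilbertSeries

variable {v : ℕ} {n : Fin v → ℕ}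

lemma hcount_union {A B : Set (MVar v n →₀ ℕ)} (h : Disjoint A B) (a : Fin v → ℕ) :
    hcount (A ∪ B) a = hcount A a + hcount B a := by
  rw [hcount, hcount, hcount, ← Set.ncard_union_eq
    (h.mono (fun _ hm => hm.1) fun _ hm => hm.1) ((finite_mdeg a).subset fun _ hm => hm.2)
    ((finite_mdeg a).subset fun _ hm => hm.2)]
  congr 1
  ext m
  simp only [Set.mem_ofPred_eq, Set.mem_union]
  tauto

lemma hcount_shift (A : Set (MVar v n →₀ ℕ)) (x : MVar v n) (a : Fin v → ℕ) :
    hcount ((fun m => m + Finsupp.single x 1) '' A) (a + Pi.single x.1 1) = hcount A a := by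
  rw [hcount, hcount, ← Set.ncard_image_of_injective {m ∈ A | mdeg m = a}
    (add_left_injective (Finsupp.single x 1))]
  congr 1
  ext m
  simp only [Set.mem_ofPred_eq, Set.mem_image]
  constructor
  · rintro ⟨⟨m', hm', rfl⟩, h⟩
    rw [mdeg_add, mdeg_single] at h
    exact ⟨m', ⟨hm', add_right_cancel h⟩, rfl⟩
  · rintro ⟨m', ⟨hm', rfl⟩, rfl⟩
    exact ⟨⟨m', hm', rfl⟩, by rw [mdeg_add, mdeg_single]⟩

lemma hcount_iUnion {ι : Type} (s : Finset ι) (A : ι → Set (MVar v n →₀ ℕ))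
    (h : ∀ i j, i ≠ j → Disjoint (A i) (A j)) (a : Fin v → ℕ) :
    hcount (⋃ i ∈ s, A i) a = ∑ i ∈ s, hcount (A i) a := by
  classical
  induction s using Finset.induction_on with
  | empty => simp [hcount]
  | insert i s hi ih =>
    rw [Finset.set_biUnion_insert, hcount_union, ih, Finset.sum_insert hi]
    rw [Set.disjoint_iUnion₂_right]
    intro j hj
    exact h i j (by rintro rfl; exact hi hj)

lemma eq_of_subset_of_hcount_eq {A B : Set (MVar v n →₀ ℕ)} (h : A ⊆ B)
    (hh : ∀ a, hcount A a = hcount B a) : A = B := by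
  refine h.antisymm fun m hm => ?_
  have := Set.eq_of_subset_of_ncard_le (s := {m' ∈ A | mdeg m' = mdeg m})
    (t := {m' ∈ B | mdeg m' = mdeg m}) (fun _ hm => ⟨h hm.1, hm.2⟩) (hh _).ge
    ((finite_mdeg (mdeg m)).subset fun _ hm => hm.2)
  have hm' : m ∈ {m' ∈ A | mdeg m' = mdeg m} := this ▸ ⟨hm, rfl⟩
  exact hm'.1

/-- The Hilbert series of a set of monomials. -/
def hser (A : Set (MVar v n →₀ ℕ)) : MvPowerSeries (Fin v) ℤ := fun d => (hcount A d : ℤ)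

lemma coeff_hser (A : Set (MVar v n →₀ ℕ)) (d : Fin v →₀ ℕ) :
    MvPowerSeries.coeff d (hser A) = hcount A d := rfl

lemma hser_union {A B : Set (MVar v n →₀ ℕ)} (h : Disjoint A B) :
    hser (A ∪ B) = hser A + hser B := by
  ext d
  rw [map_add, coeff_hser, coeff_hser, coeff_hser, hcount_union h, Nat.cast_add]

lemma hser_iUnion {ι : Type} (s : Finset ι) (A : ι → Set (MVar v n →₀ ℕ))
    (h : ∀ i j, i ≠ j → Disjoint (A i) (A j)) :
    hser (⋃ i ∈ s, A i) = ∑ i ∈ s, hser (A i) := by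
  ext d
  rw [map_sum, coeff_hser, hcount_iUnion s A h, Nat.cast_sum]
  rfl

lemma hser_shift (A : Set (MVar v n →₀ ℕ)) (x : MVar v n) :
    hser ((fun m => m + Finsupp.single x 1) '' A) = MvPowerSeries.X x.1 * hser A := by
  ext d
  rw [MvPowerSeries.X, MvPowerSeries.coeff_monomial_mul, one_mul, coeff_hser]
  split_ifs with h
  · rw [coeff_hser, Nat.cast_inj, ← hcount_shift A x]
    congr 1
    funext i
    have := h i
    rw [Pi.add_apply, Finsupp.tsub_apply, Pi.single_apply, Finsupp.single_apply]
    rw [Finsupp.single_apply] at this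
    split_ifs at * <;> omega
  · rw [Nat.cast_eq_zero, hcount, Set.ncard_eq_zero ((finite_mdeg d).subset fun _ hm => hm.2)]
    ext m
    simp only [Set.mem_ofPred_eq, Set.mem_image, Set.mem_empty_iff_false, iff_false]
    rintro ⟨⟨m', -, rfl⟩, hd⟩
    refine h ?_
    rw [Finsupp.single_le_iff, ← hd, mdeg_add, mdeg_single]
    simp

/-- The monomials obtained from `u` by raising the exponents of the variables in `Z`. -/
def cone (u : MVar v n →₀ ℕ) (Z : Finset (MVar v n)) : Set (MVar v n →₀ ℕ) :=
  {m | ∀ x, u x ≤ m x ∧ (x ∉ Z → m x = u x)}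

lemma hser_cone_empty (u : MVar v n →₀ ℕ) :
    hser (cone u ∅) = MvPowerSeries.monomial (Finsupp.equivFunOnFinite.symm (mdeg u)) (1 : ℤ) := by
  have hc : cone u ∅ = {u} := by
    ext m
    simp only [cone, Finset.notMem_empty, not_false_eq_true, forall_const, Set.mem_ofPred_eq,
      Set.mem_singleton_iff]
    exact ⟨fun h => Finsupp.ext fun x => (h x).2, by rintro rfl; simp⟩
  ext d
  rw [coeff_hser, MvPowerSeries.coeff_monomial, hc, hcount]
  split_ifs with h
  · rw [show {m | m ∈ ({u} : Set (MVar v n →₀ ℕ)) ∧ mdeg m = d} = {u} by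
      ext m
      simp only [Set.mem_singleton_iff, Set.mem_ofPred_eq, and_iff_left_iff_imp]
      rintro rfl
      rw [h]
      rfl]
    simp
  · rw [show {m | m ∈ ({u} : Set (MVar v n →₀ ℕ)) ∧ mdeg m = d} = ∅ by
      ext m
      simp only [Set.mem_singleton_iff, Set.mem_ofPred_eq, Set.mem_empty_iff_false, iff_false,
        not_and]
      rintro rfl hm
      refine h (DFunLike.ext' ?_)
      rw [← hm]
      rfl]
    simp

lemma hser_cone_insert (u : MVar v n →₀ ℕ) {Z : Finset (MVar v n)} {x : MVar v n} (hx : x ∉ Z) :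
    hser (cone u (insert x Z)) * (1 - MvPowerSeries.X x.1) = hser (cone u Z) := by
  have hU : cone u (insert x Z) =
      cone u Z ∪ (fun m => m + Finsupp.single x 1) '' cone u (insert x Z) := by
    ext m
    constructor
    · intro hm
      by_cases h : m x = u x
      · refine Or.inl fun y => ⟨(hm y).1, fun hy => ?_⟩
        by_cases hyx : y = x
        · rw [hyx, h]
        · exact (hm y).2 (by simp [hyx, hy])
      · have hlt : u x + 1 ≤ m x := Nat.succ_le_of_lt (lt_of_le_of_ne (hm x).1 (Ne.symm h))
        refine Or.inr ⟨m - Finsupp.single x 1, fun y => ?_, tsub_add_cancel_of_le ?_⟩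
        · have := hm y
          rw [Finsupp.tsub_apply, Finsupp.single_apply]
          split_ifs with hxy
          · subst hxy
            exact ⟨by omega, fun h => absurd (Finset.mem_insert_self _ _) h⟩
          · simpa using this
        · rw [Finsupp.single_le_iff]
          omega
    · rintro (hm | ⟨m, hm, rfl⟩)
      · exact fun y => ⟨(hm y).1, fun hy => (hm y).2 fun h => hy (Finset.mem_insert_of_mem h)⟩
      · intro y
        have := hm y
        rw [Finsupp.add_apply, Finsupp.single_apply]
        refine ⟨this.1.trans (Nat.le_add_right _ _), fun hy => ?_⟩
        rw [if_neg, add_zero]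
        · exact this.2 hy
        · rintro rfl
          exact hy (Finset.mem_insert_self _ _)
  have hd : Disjoint (cone u Z) ((fun m => m + Finsupp.single x 1) '' cone u (insert x Z)) := by
    rw [Set.disjoint_left]
    rintro _ hm ⟨m, hm', rfl⟩
    have h1 := (hm x).2 hx
    have h2 := (hm' x).1
    rw [Finsupp.add_apply, Finsupp.single_eq_same] at h1
    omega
  have := hser_union hd
  rw [← hU, hser_shift] at this
  rw [mul_sub, mul_one, mul_comm (hser (cone u (insert x Z))) (MvPowerSeries.X x.1)]
  nth_rewrite 1 [this]
  ring

lemma hser_cone (u : MVar v n →₀ ℕ) (Z : Finset (MVar v n)) :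
    hser (cone u Z) * ∏ x ∈ Z, (1 - MvPowerSeries.X x.1) =
      MvPowerSeries.monomial (Finsupp.equivFunOnFinite.symm (mdeg u)) (1 : ℤ) := by
  induction Z using Finset.induction_on with
  | empty => rw [Finset.prod_empty, mul_one, hser_cone_empty]
  | insert x Z hx ih => rw [Finset.prod_insert hx, ← mul_assoc, hser_cone_insert u hx, ih]

/-- The monomial with constant exponent `D`. -/
def boxTop (D : ℕ) : MVar v n →₀ ℕ := Finsupp.equivFunOnFinite.symm fun _ => D

/-- Membership in `E` only depends on exponents cut off at `D`. -/
def IsPeriodic (D : ℕ) (E : Set (MVar v n →₀ ℕ)) : Prop := ∀ m, m ∈ E ↔ m ⊓ boxTop D ∈ E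

open Classical in
/-- The numerator of the Hilbert series of the complement of a periodic set of monomials. -/
def numer (D : ℕ) (E : Set (MVar v n →₀ ℕ)) : MvPolynomial (Fin v) ℤ :=
  ∑ u ∈ (Finset.Icc 0 (boxTop D)).filter (· ∉ E),
    monomial (Finsupp.equivFunOnFinite.symm (mdeg u)) 1 *
      ∏ x ∈ Finset.univ.filter fun x => u x ≠ D, (1 - X x.1)

lemma hser_compl_mul {D : ℕ} {E : Set (MVar v n →₀ ℕ)} (hE : IsPeriodic D E) :
    hser Eᶜ * ∏ x : MVar v n, (1 - MvPowerSeries.X x.1) = (numer D E : MvPowerSeries (Fin v) ℤ) := by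
  classical
  have hdec : Eᶜ = ⋃ u ∈ (Finset.Icc 0 (boxTop D)).filter (· ∉ E), {m | m ⊓ boxTop D = u} := by
    ext m
    simp only [Set.mem_compl_iff, Finset.mem_filter, Finset.mem_Icc, zero_le, true_and,
      Set.mem_iUnion, Set.mem_ofPred_eq, exists_prop, exists_eq_right']
    rw [hE m]
    simp
  have hcone : ∀ u ∈ (Finset.Icc 0 (boxTop D)).filter (· ∉ E),
      {m | m ⊓ boxTop D = u} = cone u (Finset.univ.filter fun x => u x = D) := by
    intro u hu
    ext m
    have huD : ∀ x, u x ≤ D := by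
      simp only [Finset.mem_filter, Finset.mem_Icc] at hu
      exact fun x => hu.1.2 x
    simp only [Set.mem_ofPred_eq, cone, Finset.mem_filter, Finset.mem_univ, true_and]
    constructor
    · rintro rfl x
      rw [Finsupp.inf_apply]
      change min (m x) D ≤ m x ∧ (min (m x) D ≠ D → m x = min (m x) D)
      omega
    · intro h
      ext x
      rw [Finsupp.inf_apply]
      change min (m x) D = u x
      have h1 := h x
      have h2 := huD x
      by_cases h3 : u x = D
      · omega
      · have := h1.2 h3
        omega
  rw [hdec, hser_iUnion, numer, ← coeToMvPowerSeries.ringHom_apply, map_sum, Finset.sum_mul]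
  · refine Finset.sum_congr rfl fun u hu => ?_
    rw [hcone u hu, ← Finset.prod_filter_mul_prod_filter_not Finset.univ (fun x => u x = D),
      ← mul_assoc, hser_cone, map_mul, map_prod]
    simp only [coeToMvPowerSeries.ringHom_apply, coe_monomial, map_sub, map_one, coe_X]
  · intro u u' h
    rw [Set.disjoint_left]
    rintro m rfl h'
    exact h h'

lemma hcount_compl {E F : Set (MVar v n →₀ ℕ)} (h : ∀ a, hcount E a = hcount F a) :
    hser Eᶜ = hser Fᶜ := by
  ext d
  have h1 := hcount_union (disjoint_compl_right (a := E)) d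
  have h2 := hcount_union (disjoint_compl_right (a := F)) d
  rw [Set.union_compl_self] at h1 h2
  have := h d
  rw [coeff_hser, coeff_hser]
  omega

lemma numer_eq {D : ℕ} {E F : Set (MVar v n →₀ ℕ)} (hE : IsPeriodic D E) (hF : IsPeriodic D F)
    (h : ∀ a, hcount E a = hcount F a) : numer D E = numer D F := by
  apply MvPolynomial.coe_injective
  rw [← hser_compl_mul hE, ← hser_compl_mul hF, hcount_compl h]

lemma exists_isPeriodic {E : Set (MVar v n →₀ ℕ)} (hE : IsUpperSet E) :
    ∃ D, ∀ D' ≥ D, IsPeriodic D' E := by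
  have hfin : {m | Minimal (· ∈ E) m}.Finite :=
    (setOfPred_minimal_antichain _).finite_of_partiallyWellOrderedOn
      (Set.isPWO_of_wellQuasiOrderedLE _)
  refine ⟨hfin.toFinset.sup fun m => Finset.univ.sup m, fun D hD m => ⟨fun hm => ?_, fun hm => ?_⟩⟩
  · obtain ⟨b, hbm, hb⟩ := exists_minimal_le_of_wellFoundedLT (· ∈ E) m hm
    refine hE (le_inf hbm fun x => ?_) hb.prop
    refine le_trans ?_ hD
    refine le_trans ?_ (Finset.le_sup (hfin.mem_toFinset.mpr hb))
    exact Finset.le_sup (f := fun x => b x) (Finset.mem_univ x)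
  · exact hE inf_le_left hm

end HilbertSeries


section Rigidity

variable {v : ℕ} {n : Fin v → ℕ}

lemma mdeg_move (m : MVar v n →₀ ℕ) (i : Fin v) (j k : Fin (n i + 1)) :
    mdeg (m.erase ⟨i, j⟩ + Finsupp.single ⟨i, k⟩ (m ⟨i, j⟩)) = mdeg m := by
  conv_rhs => rw [← Finsupp.erase_add_single (⟨i, j⟩ : MVar v n) m]
  rw [mdeg_add, mdeg_add, mdeg_single, mdeg_single]

lemma sum_single_apply (c : ∀ i, Fin (n i + 1)) (a : Fin v → ℕ) (i : Fin v) (j : Fin (n i + 1)) :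
    (∑ i', Finsupp.single (⟨i', c i'⟩ : MVar v n) (a i')) ⟨i, j⟩ = if c i = j then a i else 0 := by
  rw [Finsupp.finsetSum_apply, Finset.sum_eq_single i]
  · rw [Finsupp.single_apply]
    simp only [Sigma.mk.injEq, heq_eq_eq, true_and]
  · intro b _ hb
    rw [Finsupp.single_apply, if_neg]
    intro h
    exact hb (congr_arg Sigma.fst h)
  · simp

lemma Movable.collapse_mem {E : Set (MVar v n →₀ ℕ)} (hW : Movable E) (c : ∀ i, Fin (n i + 1)) :
    ∀ (k : ℕ) (m : MVar v n →₀ ℕ), (m.support.filter fun x => x.2 ≠ c x.1).card = k → m ∈ E →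
      (∀ i j, m ⟨i, j⟩ ≠ 0 → c i ≤ j) → ∑ i, Finsupp.single (⟨i, c i⟩ : MVar v n) (mdeg m i) ∈ E := by
  intro k
  induction k with
  | zero =>
    intro m hk hm hc
    convert hm using 1
    rw [Finset.card_eq_zero, Finset.filter_eq_empty_iff] at hk
    have h0 : ∀ i j, j ≠ c i → m ⟨i, j⟩ = 0 := by
      intro i j hj
      by_contra h
      exact hk (Finsupp.mem_support_iff.mpr h) hj
    ext ⟨i, j⟩
    rw [sum_single_apply]
    split_ifs with h
    · subst h
      rw [mdeg_apply, Finset.sum_eq_single (c i)]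
      · intro b _ hb
        exact h0 i b hb
      · simp
    · exact (h0 i j (Ne.symm h)).symm
  | succ k ih =>
    intro m hk hm hc
    have hne0 : (m.support.filter fun x => x.2 ≠ c x.1).Nonempty := by
      rw [← Finset.card_pos]
      omega
    obtain ⟨⟨i, j⟩, hx⟩ := hne0
    have hx' := hx
    rw [Finset.mem_filter, Finsupp.mem_support_iff] at hx
    have hlt : c i < j := lt_of_le_of_ne (hc i j hx.1) (Ne.symm hx.2)
    have hne : (⟨i, c i⟩ : MVar v n) ≠ ⟨i, j⟩ := by
      simp only [ne_eq, Sigma.mk.injEq, heq_eq_eq, true_and]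
      exact hlt.ne
    have := ih (m.erase ⟨i, j⟩ + Finsupp.single ⟨i, c i⟩ (m ⟨i, j⟩)) ?_ (hW m hm i j (c i) hlt) ?_
    · rwa [mdeg_move] at this
    · rw [← Nat.succ_inj, Nat.succ_eq_add_one, Nat.succ_eq_add_one, ← hk,
        ← Finset.card_erase_add_one hx']
      congr 2
      ext ⟨i', j'⟩
      simp only [Finset.mem_filter, Finsupp.mem_support_iff, Finsupp.add_apply,
        Finsupp.erase_apply, Finsupp.single_apply, Finset.mem_erase]
      by_cases h1 : (⟨i', j'⟩ : MVar v n) = ⟨i, j⟩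
      · rw [if_pos h1, if_neg (h1 ▸ hne)]
        simp [h1]
      · rw [if_neg h1]
        by_cases h2 : (⟨i, c i⟩ : MVar v n) = ⟨i', j'⟩
        · have h3 : j' = c i' := by
            cases h2
            rfl
          simp [h3]
        · simp [h1, h2]
    · intro i' j' h
      rw [Finsupp.add_apply, Finsupp.erase_apply, Finsupp.single_apply] at h
      by_cases h2 : (⟨i, c i⟩ : MVar v n) = ⟨i', j'⟩
      · cases h2
        exact le_rfl
      · rw [if_neg h2, add_zero] at h
        split_ifs at h with h1
        · exact absurd rfl h
        · exact hc i' j' h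

/-- The monomial `m` only involves variables of index at least `b i` in row `i`. -/
def Above (b : Fin v → ℕ) (m : MVar v n →₀ ℕ) : Prop := ∀ i j, m ⟨i, j⟩ ≠ 0 → b i ≤ j.val

lemma Movable.exists_collapse {E : Set (MVar v n →₀ ℕ)} (hW : Movable E) {m : MVar v n →₀ ℕ}
    (hm : m ∈ E) {b : Fin v → ℕ} (hb : Above b m) :
    ∃ m' ∈ E, ∀ i j, m' ⟨i, j⟩ ≠ 0 → j.val = b i := by
  have hlt : ∀ i j, m ⟨i, j⟩ ≠ 0 → b i < n i + 1 := fun i j h => (hb i j h).trans_lt j.2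
  set c : ∀ i, Fin (n i + 1) := fun i => if h : b i < n i + 1 then ⟨b i, h⟩ else 0 with hc
  have hcb : ∀ i j, m ⟨i, j⟩ ≠ 0 → (c i).val = b i := fun i j h => by
    rw [hc]
    simp only [dif_pos (hlt i j h)]
  refine ⟨_, Movable.collapse_mem hW c _ m rfl hm fun i j h => ?_, fun i j h => ?_⟩
  · rw [Fin.le_def, hcb i j h]
    exact hb i j h
  · rw [sum_single_apply] at h
    split_ifs at h with h1
    · rw [mdeg_apply] at h
      obtain ⟨j', -, hj'⟩ := Finset.exists_ne_zero_of_sum_ne_zero h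
      rw [← h1, hcb i j' hj']
    · exact absurd rfl h

lemma coeff_shifted_numer (D : ℕ) (E : Set (MVar v n →₀ ℕ)) (b : Fin v → ℕ)
    [DecidablePred (· ∉ E)] :
    coeff (Finsupp.equivFunOnFinite.symm b) (aeval (fun i : Fin v => (1 - X i : MvPolynomial (Fin v) ℤ)) (numer D E)) =
      ∑ u ∈ (Finset.Icc 0 (boxTop D)).filter (· ∉ E),
        if ∀ i, (Finset.univ.filter fun j => u ⟨i, j⟩ ≠ D).card ≤ b i then
          coeff (Finsupp.equivFunOnFinite.symm b - Finsupp.equivFunOnFinite.symm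
            fun i => (Finset.univ.filter fun j => u ⟨i, j⟩ ≠ D).card)
            (aeval (fun i : Fin v => (1 - X i : MvPolynomial (Fin v) ℤ))
              (monomial (Finsupp.equivFunOnFinite.symm (mdeg u)) (1 : ℤ)))
        else 0 := by
  classical
  rw [numer, map_sum, coeff_sum]
  refine Finset.sum_congr (by congr!) fun u _ => ?_
  have hZ : aeval (fun i : Fin v => (1 - X i : MvPolynomial (Fin v) ℤ))
      (∏ x ∈ Finset.univ.filter fun x => u x ≠ D, (1 - X x.1 : MvPolynomial (Fin v) ℤ)) =
      monomial (Finsupp.equivFunOnFinite.symm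
            fun i => (Finset.univ.filter fun j => u ⟨i, j⟩ ≠ D).card) 1 := by
    rw [map_prod]
    simp only [map_sub, map_one, aeval_X, sub_sub_cancel]
    rw [monomial_eq, C_1, one_mul, Finsupp.prod_fintype _ _ (by simp), Finset.prod_filter,
      Fintype.prod_sigma]
    refine Finset.prod_congr rfl fun i _ => ?_
    rw [← Finset.prod_filter]
    exact Finset.prod_const (X i)
  rw [map_mul, hZ, coeff_mul_monomial', mul_one]
  exact if_congr Iff.rfl rfl rfl

lemma coeff_zero_shift (a : Fin v →₀ ℕ) :
    coeff 0 (aeval (fun i : Fin v => (1 - X i : MvPolynomial (Fin v) ℤ)) (monomial a (1 : ℤ))) =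
      1 := by
  rw [← constantCoeff_eq, aeval_monomial, Finsupp.prod]
  simp

/-- If each row of `u` has few entries different from `D` then it has an early entry `D`. -/
lemma exists_early {D : ℕ} {u : MVar v n →₀ ℕ} {b : ℕ} {i : Fin v}
    (h : (Finset.univ.filter fun j => u ⟨i, j⟩ ≠ D).card ≤ b) :
    ∃ c ≤ b, c ≤ n i + 1 ∧ ∀ j : Fin (n i + 1), j.val = c → u ⟨i, j⟩ = D := by
  by_contra! hcon
  have hb : b < n i + 1 := by
    by_contra! hb
    obtain ⟨j, hj, -⟩ := hcon (n i + 1) hb le_rfl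
    omega
  have : (Finset.univ.filter fun j : Fin (n i + 1) => j.val < b + 1).card ≤
      (Finset.univ.filter fun j => u ⟨i, j⟩ ≠ D).card := by
    refine Finset.card_le_card fun j hj => ?_
    simp only [Finset.mem_filter, Finset.mem_univ, true_and] at hj ⊢
    obtain ⟨j', hj', h'⟩ := hcon j.val (by omega) (by omega)
    rwa [Fin.ext hj'] at h'
  rw [Fin.card_filter_val_lt] at this
  omega

theorem eq_of_hcount_eq {E J : Set (MVar v n →₀ ℕ)} (hE : IsUpperSet E) (hJ : IsUpperSet J)
    (hEW : Movable E) (hJW : Movable J)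
    (hsq : ∀ m ∈ J, ∀ m' : MVar v n →₀ ℕ, m.support ⊆ m'.support → m' ∈ J)
    (h : ∀ a, hcount E a = hcount J a) : E = J := by
  classical
  refine eq_of_subset_of_hcount_eq (fun m₀ hm₀ => ?_) h
  by_contra hm₀J
  set G : (Fin v → ℕ) → Prop := fun b => (∀ i, b i ≤ n i + 1) ∧ (∀ m ∈ J, ¬ Above b m) ∧
    ∃ m ∈ E, Above b m with hG
  have hsq' : ∀ m ∈ J, ∀ b : Fin v → ℕ, Above b m → ∀ u : MVar v n →₀ ℕ,
      (∀ i (j : Fin (n i + 1)), j.val = b i → u ⟨i, j⟩ ≠ 0) → u ∈ J := by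
    intro m hm b hb u hu
    obtain ⟨m', hm', h'⟩ := Movable.exists_collapse hJW hm hb
    refine hsq m' hm' u fun ⟨i, j⟩ hx => ?_
    exact Finsupp.mem_support_iff.mpr (hu i j (h' i j (Finsupp.mem_support_iff.mp hx)))
  have hex : ∃ b, G b := by
    have hc : ∀ i : Fin v, ∃ c ≤ n i + 1, (∀ j : Fin (n i + 1), m₀ ⟨i, j⟩ ≠ 0 → c ≤ j.val) ∧
        ∀ j : Fin (n i + 1), j.val = c → m₀ ⟨i, j⟩ ≠ 0 := by
      intro i
      by_cases hi : ∃ j, m₀ ⟨i, j⟩ ≠ 0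
      · obtain ⟨z, hz, hmin⟩ := (Finset.univ.filter fun j => m₀ ⟨i, j⟩ ≠ 0).exists_min_image id
          (by obtain ⟨j, hj⟩ := hi; exact ⟨j, by simpa using hj⟩)
        simp only [Finset.mem_filter, Finset.mem_univ, true_and, id] at hz hmin
        exact ⟨z.val, z.2.le, fun j hj => hmin j hj, fun j hj => Fin.ext hj ▸ hz⟩
      · push Not at hi
        exact ⟨n i + 1, le_rfl, fun j hj => absurd (hi j) hj, fun j hj => by omega⟩
    choose c hc1 hc2 hc3 using hc
    exact ⟨c, hc1, fun m hm hmc => hm₀J (hsq' m hm c hmc m₀ hc3), m₀, hm₀, hc2⟩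
  obtain ⟨b₀, hb₀⟩ := hex
  obtain ⟨b, -, hb⟩ := exists_minimal_le_of_wellFoundedLT G b₀ hb₀
  obtain ⟨hbn, hbJ, m₁, hm₁, hbm₁⟩ := hb.prop
  obtain ⟨D₁, hD₁⟩ := exists_isPeriodic hE
  obtain ⟨D₂, hD₂⟩ := exists_isPeriodic hJ
  set D := max (max D₁ D₂) 1 with hD
  have hDE : IsPeriodic D E := hD₁ D (by omega)
  have hDJ : IsPeriodic D J := hD₂ D (by omega)
  have hD0 : D ≠ 0 := by omega
  have key := congr_arg (fun P => coeff (Finsupp.equivFunOnFinite.symm b)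
    (aeval (fun i : Fin v => (1 - X i : MvPolynomial (Fin v) ℤ)) P)) (numer_eq hDE hDJ h)
  simp only [coeff_shifted_numer] at key
  rw [Finset.sum_eq_zero] at key
  swap
  · intro u hu
    rw [Finset.mem_filter] at hu
    refine if_neg fun hz => hu.2 ?_
    choose c hcb hcn hc using fun i => exists_early (hz i)
    obtain ⟨m', hm', h'⟩ := Movable.exists_collapse hEW hm₁ (b := c)
      fun i j hj => (hcb i).trans (hbm₁ i j hj)
    refine hE (fun ⟨i, j⟩ => ?_) ((hDE m').mp hm')
    rw [Finsupp.inf_apply]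
    by_cases h0 : m' ⟨i, j⟩ = 0
    · rw [h0]
      exact (min_le_left _ _).trans (Nat.zero_le _)
    · rw [hc i j (h' i j h0)]
      exact min_le_right _ _
  set us : MVar v n →₀ ℕ := Finsupp.equivFunOnFinite.symm fun x => if x.2.val < b x.1 then 0 else D
    with hus
  have hus_apply : ∀ i j, us ⟨i, j⟩ = if j.val < b i then 0 else D := fun _ _ => rfl
  have husz : ∀ i, (Finset.univ.filter fun j => us ⟨i, j⟩ ≠ D).card = b i := by
    intro i
    have : (Finset.univ.filter fun j => us ⟨i, j⟩ ≠ D) =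
        Finset.univ.filter fun j : Fin (n i + 1) => j.val < b i := by
      ext j
      simp only [Finset.mem_filter, Finset.mem_univ, true_and, hus_apply]
      split_ifs with h1
      · simp [h1, hD0.symm]
      · simp [h1]
    rw [this, Fin.card_filter_val_lt]
    exact min_eq_right (hbn i)
  rw [Finset.sum_eq_single us] at key
  · rw [if_pos fun i => (husz i).le] at key
    simp only [husz, tsub_self, coeff_zero_shift] at key
    exact zero_ne_one key
  · intro u hu hne
    rw [Finset.mem_filter] at hu
    refine if_neg fun hz => hne ?_
    choose c hcb hcn hc using fun i => exists_early (hz i)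
    have h0 : ∀ i j, j.val < b i → u ⟨i, j⟩ = 0 := by
      intro i j hj
      by_contra hu0
      have hle : Function.update c i j.val ≤ b := fun i' => by
        by_cases hi : i' = i
        · subst hi
          simpa using hj.le
        · rw [Function.update_of_ne hi]
          exact hcb i'
      have hnG : ¬ G (Function.update c i j.val) := fun hGc => by
        have h2 : b i ≤ Function.update c i j.val i := hb.le_of_le hGc hle i
        rw [Function.update_self] at h2
        omega
      refine hnG ⟨fun i' => (hle i').trans (hbn i'), fun m hm hab => hu.2 ?_, m₁, hm₁,
        fun i' j' h' => (hle i').trans (hbm₁ i' j' h')⟩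
      refine hsq' m hm _ hab u fun i' j' h' => ?_
      by_cases hi : i' = i
      · subst hi
        rw [Function.update_self] at h'
        rwa [Fin.ext h']
      · rw [Function.update_of_ne hi] at h'
        rw [hc i' j' h']
        exact hD0
    ext ⟨i, j⟩
    rw [hus_apply]
    split_ifs with hj
    · exact h0 i j hj
    · by_contra huD
      have hss : (Finset.univ.filter fun j : Fin (n i + 1) => j.val < b i) ⊂
          Finset.univ.filter fun j => u ⟨i, j⟩ ≠ D := by
        refine Finset.ssubset_iff_subset_ne.mpr ⟨fun j' hj' => ?_, fun he => ?_⟩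
        · simp only [Finset.mem_filter, Finset.mem_univ, true_and] at hj' ⊢
          rw [h0 i j' hj']
          exact hD0.symm
        · have : j ∈ Finset.univ.filter fun j : Fin (n i + 1) => j.val < b i := by
            rw [he]
            simpa using huD
          simp only [Finset.mem_filter, Finset.mem_univ, true_and] at this
          exact hj this
      have h1 := Finset.card_lt_card hss
      rw [Fin.card_filter_val_lt, min_eq_right (hbn i)] at h1
      exact absurd (hz i) (not_le.mpr h1)
  · intro hus'
    refine absurd ?_ hus'
    rw [Finset.mem_filter, Finset.mem_Icc]
    refine ⟨⟨zero_le, fun ⟨i, j⟩ => ?_⟩, fun hJus => hbJ us hJus fun i j hj => ?_⟩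
    · rw [hus_apply]
      split_ifs
      · exact Nat.zero_le _
      · exact le_rfl
    · rw [hus_apply] at hj
      split_ifs at hj with h1
      · exact absurd rfl hj
      · exact not_lt.mp h1

end Rigidity


section Degeneration

variable {K : Type} [Field K] {v : ℕ} {n : Fin v → ℕ}

lemma exists_monomialOrder_antitone (V : Type) [Finite V] [LinearOrder V] :
    ∃ τ : MonomialOrder.{0, 0} V, ∀ x y : V, y ≤ x →
      τ.toSyn (Finsupp.single x 1) ≤ τ.toSyn (Finsupp.single y 1) := by
  haveI : WellFoundedGT V := Finite.to_wellFoundedGT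
  refine ⟨MonomialOrder.lex, fun x y h => ?_⟩
  rw [MonomialOrder.lex_le_iff, Finsupp.Lex.single_le_iff]
  exact h

lemma exists_monomialOrder_row_antitone (n : Fin v → ℕ) : ∃ τ : MonomialOrder.{0, 0} (MVar v n),
    ∀ (i : Fin v) (j k : Fin (n i + 1)), k < j →
      τ.toSyn (Finsupp.single ⟨i, j⟩ 1) ≤ τ.toSyn (Finsupp.single ⟨i, k⟩ 1) := by
  obtain ⟨τ, hτ⟩ := @exists_monomialOrder_antitone (MVar v n) inferInstance
    (LinearOrder.lift' (toLex : MVar v n → Σₗ i, Fin (n i + 1)) toLex.injective)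
  exact ⟨τ, fun i j k h => hτ _ _ (Sigma.Lex.right _ _ h.le)⟩

lemma trans_weightedHomogeneousComponent {V : Type} [Fintype V] [DecidableEq V] {A : Type}
    [AddCommMonoid A] {u : V → A} {x w : V} (h : u x = u w) (c : K) (a : A)
    (f : MvPolynomial V K) :
    trans x w c (weightedHomogeneousComponent u a f) =
      weightedHomogeneousComponent u a (trans x w c f) := by
  classical
  induction f using MvPolynomial.induction_on' with
  | monomial m r =>
    have h1 : IsWeightedHomogeneous u (monomial m r) (Finsupp.weight u m) :=
      isWeightedHomogeneous_monomial _ _ _ rfl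
    rw [weightedHomogeneousComponent_of_mem (n := Finsupp.weight u m) h1,
      weightedHomogeneousComponent_of_mem (n := Finsupp.weight u m)
        (trans_isWeightedHomogeneous h c h1)]
    split_ifs
    · rfl
    · exact map_zero _
  | add p q hp hq => simp only [map_add, hp, hq]

lemma component_one_mem {I : Ideal (MvPolynomial (MVar v n) K)} (hI : IsMultigraded I)
    {f : MvPolynomial (MVar v n) K} (hf : f ∈ I) (e : ℤ) :
    weightedHomogeneousComponent (fun _ => (1 : ℤ)) e f ∈ I := by
  classical
  suffices h : weightedHomogeneousComponent (fun _ => (1 : ℤ)) e f =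
      ∑ a ∈ (f.support.image mdeg).filter (fun a => ∑ i, (a i : ℤ) = e),
        weightedHomogeneousComponent (wt v n) a f by
    rw [h]
    exact I.sum_mem fun a _ => hI f hf a
  ext m
  rw [coeff_weightedHomogeneousComponent, coeff_sum]
  change (if tdeg m = e then _ else _) = _
  simp only [coeff_weightedHomogeneousComponent]
  change _ = ∑ a ∈ _, if mdeg m = a then _ else _
  rw [Finset.sum_ite_eq, tdeg_eq_sum_mdeg]
  by_cases hm : coeff m f = 0
  · simp [hm]
  · have : mdeg m ∈ f.support.image mdeg :=
      Finset.mem_image_of_mem _ (mem_support_iff.mpr hm)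
    simp only [Finset.mem_filter, this, true_and]

/-- The number of elements of `E` of the same multidegree as `μ` and not larger than `μ`. -/
def cnt (τ : MonomialOrder (MVar v n)) (E : Set (MVar v n →₀ ℕ)) (μ : MVar v n →₀ ℕ) : ℕ :=
  {m ∈ E | mdeg m = mdeg μ ∧ τ.toSyn m ≤ τ.toSyn μ}.ncard

variable (K) in
/-- The exponents of the leading monomials after a transvection. -/
def degen (τ : MonomialOrder (MVar v n)) (x w : MVar v n) (E : Set (MVar v n →₀ ℕ)) :
    Set (MVar v n →₀ ℕ) :=
  lead τ ((monIdeal K E).comap (trans x w (-1 : K)))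

variable {τ : MonomialOrder (MVar v n)} {x w : MVar v n} {E : Set (MVar v n →₀ ℕ)}

lemma isMultigraded_monIdeal : IsMultigraded (monIdeal K E) :=
  fun _ hf a => component_mem_monIdeal _ hf a

lemma component_mem_comap {A : Type} [AddCommMonoid A] {u : MVar v n → A} (h : u x = u w)
    {f : MvPolynomial (MVar v n) K} (hf : f ∈ (monIdeal K E).comap (trans x w (-1 : K))) (a : A) :
    weightedHomogeneousComponent u a f ∈ (monIdeal K E).comap (trans x w (-1 : K)) := by
  rw [Ideal.mem_comap, trans_weightedHomogeneousComponent h]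
  exact component_mem_monIdeal _ hf a

lemma trans_neg_trans (hxw : x ≠ w) (f : MvPolynomial (MVar v n) K) :
    trans x w 1 (trans x w (-1) f) = f := by
  have := trans_trans hxw (-1 : K) f
  rwa [neg_neg] at this

lemma wt_eq (h : x.1 = w.1) : wt v n x = wt v n w := by
  rw [wt, wt, h]

lemma finrank_comap_trans {V : Type} [Fintype V] [DecidableEq V] {A : Type}
    [AddCommMonoid A] {u : V → A} {x w : V} (hxw : x ≠ w) (h : u x = u w)
    (I : Ideal (MvPolynomial V K)) (a : A) :
    Module.finrank K ↥((I.comap (trans x w (-1 : K))).restrictScalars K ⊓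
      weightedHomogeneousSubmodule K u a) =
    Module.finrank K ↥(I.restrictScalars K ⊓ weightedHomogeneousSubmodule K u a) := by
  have h1 : ((trans x w (-1 : K)).comp (trans x w (1 : K))) = AlgHom.id K _ :=
    AlgHom.ext fun f => by rw [AlgHom.comp_apply, trans_trans hxw, AlgHom.id_apply]
  have h2 : ((trans x w (1 : K)).comp (trans x w (-1 : K))) = AlgHom.id K _ :=
    AlgHom.ext fun f => by
      have := trans_trans hxw (-1 : K) f
      rw [neg_neg] at this
      rw [AlgHom.comp_apply, this, AlgHom.id_apply]
  rw [← LinearEquiv.finrank_map_eq (AlgEquiv.ofAlgHom _ _ h1 h2).toLinearEquiv]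
  have h3 : ((I.comap (trans x w (-1 : K))).restrictScalars K ⊓
      weightedHomogeneousSubmodule K u a).map
        ((AlgEquiv.ofAlgHom _ _ h1 h2).toLinearEquiv : MvPolynomial V K →ₗ[K] MvPolynomial V K) =
      I.restrictScalars K ⊓ weightedHomogeneousSubmodule K u a := by
    ext f
    constructor
    · rintro ⟨g, ⟨hg1, hg2⟩, rfl⟩
      change trans x w (-1) g ∈ _
      exact ⟨Ideal.mem_comap.mp hg1, trans_isWeightedHomogeneous h _ hg2⟩
    · intro hf
      refine ⟨trans x w 1 f, ⟨?_, trans_isWeightedHomogeneous h _ hf.2⟩, trans_trans hxw 1 f⟩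
      rw [SetLike.mem_coe, Submodule.restrictScalars_mem, Ideal.mem_comap, trans_trans hxw]
      exact hf.1
  rw [h3]

lemma hcount_degen (hE : IsUpperSet E) (hxw : x ≠ w) (hrow : x.1 = w.1) (a : Fin v → ℕ) :
    hcount (degen K τ x w E) a = hcount E a := by
  rw [degen, ← hilb_eq_hcount_lead τ (fun f hf a => component_mem_comap (wt_eq hrow) hf a),
    ← lead_monIdeal (K := K) τ hE, ← hilb_eq_hcount_lead τ isMultigraded_monIdeal,
    lead_monIdeal τ hE, hilb, hilb]
  exact finrank_comap_trans hxw (wt_eq hrow) _ a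

lemma MonVan_of_MonVan_degen (hE : IsUpperSet E) (hxw : x ≠ w) {p : ℕ} {e : ℤ}
    (h : MonVan K (degen K τ x w E) p e) : MonVan K E p e :=
  MonVan_of_Kvan_monIdeal hE <| Kvan_of_comap_trans hxw <| Kvan_of_MonVan_lead τ
    (fun _ hf a => component_mem_comap (u := fun _ => (1 : ℤ)) rfl hf a) h

variable (K) in
/-- The homogeneous elements of the transformed ideal all of whose monomials are at most `μ`. -/
def lowSpace (τ : MonomialOrder (MVar v n)) (x w : MVar v n) (E : Set (MVar v n →₀ ℕ))
    (μ : MVar v n →₀ ℕ) : Submodule K (MvPolynomial (MVar v n) K) where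
  carrier := {f | trans x w (-1 : K) f ∈ monIdeal K E ∧
    IsWeightedHomogeneous (wt v n) f (mdeg μ) ∧ ∀ m, coeff m f ≠ 0 → τ.toSyn m ≤ τ.toSyn μ}
  zero_mem' := ⟨by rw [map_zero]; exact zero_mem _, isWeightedHomogeneous_zero _ _ _,
    fun m hm => absurd (coeff_zero m) hm⟩
  add_mem' := fun {f g} hf hg => ⟨by rw [map_add]; exact add_mem hf.1 hg.1, hf.2.1.add hg.2.1,
    fun m hm => by
      by_cases h : coeff m f = 0
      · exact hg.2.2 m fun h' => hm (by rw [coeff_add, h, h', add_zero])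
      · exact hf.2.2 m h⟩
  smul_mem' := fun r f hf => ⟨by
      rw [map_smul, smul_eq_C_mul]
      exact Ideal.mul_mem_left _ _ hf.1,
    (weightedHomogeneousSubmodule K (wt v n) (mdeg μ)).smul_mem r hf.2.1,
    fun m hm => hf.2.2 m fun h => hm (by rw [coeff_smul, h, smul_zero])⟩

lemma finrank_lowSpace (hrow : x.1 = w.1) (μ : MVar v n →₀ ℕ) :
    FiniteDimensional K (lowSpace K τ x w E μ) ∧
      Module.finrank K (lowSpace K τ x w E μ) = cnt τ (degen K τ x w E) μ := by
  refine finrank_eq_ncard_degree τ ((finite_mdeg (mdeg μ)).subset fun m hm => hm.2.1) fun m => ?_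
  constructor
  · rintro ⟨hm, hd, hle⟩
    obtain ⟨f, hf, hfh, hc, hmax⟩ := exists_monic_of_mem_lead (wt v n)
      (fun f hf a => component_mem_comap (wt_eq hrow) hf a) hm
    have hf0 : f ≠ 0 := by rintro rfl; simp at hc
    refine ⟨f, ⟨hf, hd ▸ hfh, fun m' h => (hmax m' h).trans hle⟩, hf0,
      τ.toSyn.injective (le_antisymm ?_ (τ.le_degree ?_))⟩
    · exact hmax _ (τ.leadingCoeff_ne_zero_iff.mpr hf0)
    · rw [mem_support_iff, hc]
      exact one_ne_zero
  · rintro ⟨f, ⟨hf, hfh, hle⟩, hf0, rfl⟩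
    have h0 := τ.leadingCoeff_ne_zero_iff.mpr hf0
    exact ⟨⟨f, hf, hf0, rfl⟩, hfh h0, hle _ h0⟩

lemma cnt_degen_le_and (hE : IsUpperSet E) (hxw : x ≠ w) (hrow : x.1 = w.1)
    (hτ : τ.toSyn (Finsupp.single x 1) ≤ τ.toSyn (Finsupp.single w 1)) (μ : MVar v n →₀ ℕ) :
    cnt τ (degen K τ x w E) μ ≤ cnt τ E μ ∧
      (cnt τ (degen K τ x w E) μ = cnt τ E μ → ∀ h : MvPolynomial (MVar v n) K,
        trans x w (-1 : K) h ∈ monIdeal K E → IsWeightedHomogeneous (wt v n) h (mdeg μ) →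
        coeff μ h ≠ 0 → μ ∈ degen K τ x w E) := by
  classical
  set L : Set (MVar v n →₀ ℕ) := {m ∈ E | mdeg m = mdeg μ ∧ τ.toSyn m ≤ τ.toSyn μ} with hL
  haveI : Fintype L := ((finite_mdeg (mdeg μ)).subset fun m hm => hm.2.1 : L.Finite).fintype
  obtain ⟨hfin, hrank⟩ := finrank_lowSpace (K := K) (τ := τ) (E := E) hrow μ
  have hcard : Module.finrank K (L → K) = cnt τ E μ := by
    rw [Module.finrank_fintype_fun_eq_card, ← Nat.card_eq_fintype_card]
    rfl
  -- a polynomial of the transformed ideal whose image has no monomial in `L` only has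
  -- monomials larger than `μ`
  have key : ∀ f : MvPolynomial (MVar v n) K, trans x w (-1 : K) f ∈ monIdeal K E →
      IsWeightedHomogeneous (wt v n) f (mdeg μ) →
      (∀ m : L, coeff m.1 (trans x w (-1 : K) f) = 0) →
      ∀ d, coeff d f ≠ 0 → τ.toSyn μ < τ.toSyn d := by
    intro f hf hfh h0 d hd
    rw [← trans_neg_trans hxw f] at hd
    obtain ⟨m, hm, hmd⟩ := le_of_coeff_trans_ne_zero τ hτ _ hd
    refine lt_of_lt_of_le ?_ hmd
    by_contra hle
    exact hm (h0 ⟨m, (mem_monIdeal hE).mp hf m hm,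
      trans_isWeightedHomogeneous (wt_eq hrow) _ hfh hm, not_lt.mp hle⟩)
  let ev : lowSpace K τ x w E μ →ₗ[K] (L → K) := LinearMap.pi fun m =>
    ((lcoeff K m.1).comp (trans x w (-1 : K)).toLinearMap).comp (lowSpace K τ x w E μ).subtype
  have hev : Function.Injective ev := by
    rw [← LinearMap.ker_eq_bot, LinearMap.ker_eq_bot']
    rintro ⟨f, hf⟩ h0
    refine Subtype.ext ?_
    ext d
    by_contra hd
    exact (key f hf.1 hf.2.1 (fun m => congr_fun h0 m) d hd).not_ge (hf.2.2 d hd)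
  refine ⟨?_, fun heq h hh hhom hμ => ?_⟩
  · rw [← hrank, ← hcard]
    exact LinearMap.finrank_le_finrank_of_injective hev
  · have hsurj : Function.Surjective ev := by
      rw [← LinearMap.injective_iff_surjective_of_finrank_eq_finrank (by rw [hrank, hcard, heq])]
      exact hev
    obtain ⟨⟨f, hf⟩, hfe⟩ := hsurj fun m => coeff m.1 (trans x w (-1 : K) h)
    have h2 : coeff μ (h - f) = 0 := by
      by_contra hne
      refine lt_irrefl _ (key (h - f) ?_ ?_ (fun m => ?_) μ hne)
      · rw [map_sub]
        exact sub_mem hh hf.1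
      · exact (weightedHomogeneousSubmodule K (wt v n) (mdeg μ)).sub_mem hhom hf.2.1
      · rw [map_sub, coeff_sub, sub_eq_zero]
        exact (congr_fun hfe m).symm
    rw [coeff_sub, sub_eq_zero] at h2
    exact mem_lead_of_max (I := (monIdeal K E).comap (trans x w (-1 : K))) hf.1 (h2 ▸ hμ) hf.2.2

end Degeneration


section Limit

variable {K : Type} [Field K] {v : ℕ} {n : Fin v → ℕ} {τ : MonomialOrder (MVar v n)}

lemma move_mem_of_cnt_degen_eq {x w : MVar v n} {E : Set (MVar v n →₀ ℕ)} (hE : IsUpperSet E)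
    (hxw : x ≠ w) (hrow : x.1 = w.1)
    (hτ : τ.toSyn (Finsupp.single x 1) ≤ τ.toSyn (Finsupp.single w 1)) {m : MVar v n →₀ ℕ}
    (hm : m ∈ E) (h : ∀ μ, mdeg μ = mdeg m → cnt τ (degen K τ x w E) μ = cnt τ E μ) :
    m.erase x + Finsupp.single w (m x) ∈ E := by
  have hmem : ∀ m' ∈ E, mdeg m' = mdeg m → ∀ μ, mdeg μ = mdeg m →
      coeff μ (trans x w (1 : K) (monomial m' 1)) ≠ 0 → μ ∈ degen K τ x w E := by
    intro m' hm' hd μ hμ hc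
    refine (cnt_degen_le_and (K := K) hE hxw hrow hτ μ).2 (h μ hμ)
      (trans x w (1 : K) (monomial m' 1)) ?_ ?_ hc
    · rw [trans_trans hxw, mem_monIdeal hE]
      intro d hd
      rw [coeff_monomial] at hd
      split_ifs at hd with h1
      · exact h1 ▸ hm'
      · exact absurd rfl hd
    · exact trans_isWeightedHomogeneous (wt_eq hrow) _
        (isWeightedHomogeneous_monomial _ _ _ (hd.trans hμ.symm))
  have hset : {m' ∈ E | mdeg m' = mdeg m} = {m' ∈ degen K τ x w E | mdeg m' = mdeg m} := by
    refine Set.eq_of_subset_of_ncard_le (fun m' hm' => ⟨?_, hm'.2⟩)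
      (hcount_degen hE hxw hrow (mdeg m)).le ((finite_mdeg _).subset fun _ h => h.2)
    refine hmem m' hm'.1 hm'.2 m' hm'.2 ?_
    rw [coeff_trans_monomial_self hxw]
    exact one_ne_zero
  have hmd : mdeg (m.erase x + Finsupp.single w (m x)) = mdeg m := by
    conv_rhs => rw [← Finsupp.erase_add_single x m]
    rw [mdeg_add, mdeg_add, mdeg_single, mdeg_single, hrow]
  refine (hset.symm.subset ⟨hmem m hm rfl _ hmd ?_, hmd⟩).1
  rw [coeff_trans_monomial hxw, one_pow]
  exact one_ne_zero

lemma finite_tdeg_le (D : ℤ) : {m : MVar v n →₀ ℕ | tdeg m ≤ D}.Finite := by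
  refine (Set.finite_Iic (Finsupp.equivFunOnFinite.symm fun _ => D.toNat)).subset fun m hm x => ?_
  rw [Set.mem_ofPred_eq, tdeg_eq] at hm
  have h1 := Finset.single_le_sum (f := fun x => (m x : ℤ)) (fun _ _ => Int.natCast_nonneg _)
    (Finset.mem_univ x)
  rw [Finsupp.equivFunOnFinite_symm_apply_apply]
  omega

/-- A family of sets of monomials which is stable under degeneration contains a member which is
closed under moves in bounded degree. -/
lemma exists_movable_tdeg_le
    (hτ : ∀ (i : Fin v) (j k : Fin (n i + 1)), k < j →
      τ.toSyn (Finsupp.single ⟨i, j⟩ 1) ≤ τ.toSyn (Finsupp.single ⟨i, k⟩ 1))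
    {𝒳 : Set (Set (MVar v n →₀ ℕ))} (h0 : 𝒳.Nonempty) (hup : ∀ E ∈ 𝒳, IsUpperSet E)
    (hdeg : ∀ E ∈ 𝒳, ∀ (i : Fin v) (j k : Fin (n i + 1)), k < j → degen K τ ⟨i, j⟩ ⟨i, k⟩ E ∈ 𝒳)
    (D : ℤ) : ∃ E ∈ 𝒳, ∀ m ∈ E, tdeg m ≤ D → ∀ (i : Fin v) (j k : Fin (n i + 1)), k < j →
      m.erase ⟨i, j⟩ + Finsupp.single ⟨i, k⟩ (m ⟨i, j⟩) ∈ E := by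
  obtain ⟨E, hE, hmin⟩ := (measure fun E : Set (MVar v n →₀ ℕ) =>
    ∑ μ ∈ (finite_tdeg_le (n := n) D).toFinset, cnt τ E μ).wf.has_min 𝒳 h0
  refine ⟨E, hE, fun m hm hD i j k hkj => ?_⟩
  have hxw : (⟨i, j⟩ : MVar v n) ≠ ⟨i, k⟩ := by
    simp only [ne_eq, Sigma.mk.injEq, heq_eq_eq, true_and]
    exact hkj.ne'
  have hle := fun μ => (cnt_degen_le_and (K := K) (hup E hE) hxw rfl (hτ i j k hkj) μ).1
  have hsum : ∑ μ ∈ (finite_tdeg_le (n := n) D).toFinset, cnt τ E μ ≤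
      ∑ μ ∈ (finite_tdeg_le (n := n) D).toFinset, cnt τ (degen K τ ⟨i, j⟩ ⟨i, k⟩ E) μ :=
    not_lt.mp (hmin _ (hdeg E hE i j k hkj))
  have heq := (Finset.sum_eq_sum_iff_of_le fun μ _ => hle μ).mp
    (le_antisymm (Finset.sum_le_sum fun μ _ => hle μ) hsum)
  refine move_mem_of_cnt_degen_eq (hup E hE) hxw rfl (hτ i j k hkj) hm fun μ hμ => heq μ ?_
  rw [Set.Finite.mem_toFinset, Set.mem_ofPred_eq, tdeg_eq_sum_mdeg, hμ, ← tdeg_eq_sum_mdeg]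
  exact hD

lemma exists_agree_tdeg_le
    (hτ : ∀ (i : Fin v) (j k : Fin (n i + 1)), k < j →
      τ.toSyn (Finsupp.single ⟨i, j⟩ 1) ≤ τ.toSyn (Finsupp.single ⟨i, k⟩ 1))
    {𝒳 : Set (Set (MVar v n →₀ ℕ))} (h0 : 𝒳.Nonempty) (hup : ∀ E ∈ 𝒳, IsUpperSet E)
    (hdeg : ∀ E ∈ 𝒳, ∀ (i : Fin v) (j k : Fin (n i + 1)), k < j → degen K τ ⟨i, j⟩ ⟨i, k⟩ E ∈ 𝒳)
    {J : Set (MVar v n →₀ ℕ)} (hJ : IsUpperSet J) (hJW : Movable J)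
    (hsq : ∀ m ∈ J, ∀ m' : MVar v n →₀ ℕ, m.support ⊆ m'.support → m' ∈ J)
    (hcount_eq : ∀ E ∈ 𝒳, ∀ a, hcount E a = hcount J a) (D : ℤ) :
    ∃ E ∈ 𝒳, ∀ m, tdeg m ≤ D → (m ∈ E ↔ m ∈ J) := by
  choose E hE hmov using fun d : ℕ => exists_movable_tdeg_le hτ h0 hup hdeg (d : ℤ)
  set U := Filter.hyperfilter ℕ
  set F : Set (MVar v n →₀ ℕ) := {m | ∀ᶠ d in (U : Filter ℕ), m ∈ E d} with hF
  have hagree : ∀ S : Set (MVar v n →₀ ℕ), S.Finite →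
      ∀ᶠ d in (U : Filter ℕ), ∀ m ∈ S, (m ∈ E d ↔ m ∈ F) := by
    intro S hS
    rw [Filter.eventually_all_finite hS]
    intro m _
    rcases Ultrafilter.em U (fun d => m ∈ E d) with h | h
    · exact h.mono fun d hd => ⟨fun _ => h, fun _ => hd⟩
    · refine h.mono fun d hd => ⟨fun hd' => absurd hd' hd, fun hm => ?_⟩
      obtain ⟨d', h1, h2⟩ := (h.and hm).exists
      exact absurd h2 h1
  have hFJ : F = J := by
    refine eq_of_hcount_eq ?_ hJ ?_ hJW hsq fun a => ?_
    · intro m m' hle hm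
      exact hm.mono fun d hd => hup _ (hE d) hle hd
    · intro m hm i j k hkj
      have hlarge : ∀ᶠ d : ℕ in (U : Filter ℕ), tdeg m ≤ d :=
        ((Filter.eventually_ge_atTop (tdeg m).toNat).mono fun d hd => by omega).filter_mono
          Nat.hyperfilter_le_atTop
      filter_upwards [hm, hlarge] with d h1 h2
      exact hmov d m h1 h2 i j k hkj
    · obtain ⟨d, hd⟩ := (hagree _ (finite_mdeg a)).exists
      rw [← hcount_eq _ (hE d), hcount, hcount]
      congr 1
      ext m
      exact and_congr_left fun hm => (hd m hm).symm
  obtain ⟨d, hd⟩ := (hagree _ (finite_tdeg_le D)).exists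
  exact ⟨E d, hE d, fun m hm => hFJ ▸ hd m hm⟩

lemma MonSupp.congr {V : Type} [Fintype V] [DecidableEq V] {E E' : Set (V →₀ ℕ)} {D : ℤ}
    (h : ∀ m, tdeg m ≤ D → (m ∈ E ↔ m ∈ E')) {α : V →₀ ℕ} {p : ℕ} (hα : tdeg α ≤ p + D)
    {c : Finset V → K} (hc : MonSupp E α p c) : MonSupp E' α p c := by
  intro σ hσ
  obtain ⟨h1, h2, h3⟩ := hc σ hσ
  refine ⟨h1, h2, (h _ ?_).mp h3⟩
  have h4 := congrArg tdeg (tsub_add_cancel_of_le h2)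
  rw [map_add, tdeg_ind, h1] at h4
  omega

lemma MonVan.congr {V : Type} [Fintype V] [DecidableEq V] {E E' : Set (V →₀ ℕ)} {p : ℕ} {e : ℤ}
    (h : ∀ m, tdeg m ≤ e → (m ∈ E ↔ m ∈ E')) (hE : MonVan K E p e) : MonVan K E' p e := by
  intro α hα c hc hc0
  obtain ⟨b, hb, hbc⟩ := hE α hα c (hc.congr (fun m hm => (h m hm).symm) hα.le) hc0
  exact ⟨b, hb.congr h (by push_cast; omega), hbc⟩

theorem Kvan_of_isCS [Infinite K] {I : Ideal (MvPolynomial (MVar v n) K)} (hI : IsCS I) {p : ℕ}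
    {e : ℤ} (he : (v : ℤ) < e) : Kvan (MVar v n) K (Ig I) p e := by
  obtain ⟨hgr, J, hrad, hB, hHS⟩ := hI
  obtain ⟨τ, hτ⟩ := exists_monomialOrder_row_antitone n
  have hJE := BorelFixed.eq_monIdeal hB
  have hJup := isUpperSet_expSet J
  have hsq := expSet_mem_of_support_subset hrad
  refine Kvan_of_MonVan_lead τ (fun f hf a => component_one_mem hgr hf a) ?_
  by_contra hcon
  have hJgr : IsMultigraded J := hJE ▸ isMultigraded_monIdeal
  set 𝒳 : Set (Set (MVar v n →₀ ℕ)) := {E | IsUpperSet E ∧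
    (∀ a, hcount E a = hcount (expSet J) a) ∧ ¬ MonVan K E p e}
  have h0 : lead τ I ∈ 𝒳 := by
    refine ⟨isUpperSet_lead τ I, fun a => ?_, hcon⟩
    rw [← hilb_eq_hcount_lead τ hgr, hHS, hilb_eq_hcount_lead τ hJgr,
      ← lead_monIdeal (K := K) τ hJup, ← hJE]
  have hdeg : ∀ E ∈ 𝒳, ∀ (i : Fin v) (j k : Fin (n i + 1)), k < j →
      degen K τ ⟨i, j⟩ ⟨i, k⟩ E ∈ 𝒳 := by
    intro E hE i j k hkj
    have hxw : (⟨i, j⟩ : MVar v n) ≠ ⟨i, k⟩ := by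
      simp only [ne_eq, Sigma.mk.injEq, heq_eq_eq, true_and]
      exact hkj.ne'
    exact ⟨isUpperSet_lead τ _, fun a => (hcount_degen hE.1 hxw rfl a).trans (hE.2.1 a),
      fun h => hE.2.2 (MonVan_of_MonVan_degen hE.1 hxw h)⟩
  obtain ⟨E, hE, hEJ⟩ := exists_agree_tdeg_le hτ ⟨_, h0⟩ (fun E hE => hE.1) hdeg hJup
    (BorelFixed.movable hB) hsq (fun E hE => hE.2.1) e
  exact hE.2.2 ((MonVan_of_movable hJup (BorelFixed.movable hB) hsq he).congr
    fun m hm => (hEJ m hm).symm)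

end Limit

end CSReg

/-- **Regularity bound.** If `I` is a `ℤ^v`-graded Cartwright-Sturmfels ideal of `S`, then
`reg(I) ≤ v`: in every minimal `ℤ`-graded free resolution of `I` (with respect to the
standard grading by total degree), every shift in homological degree `p` is at most
`v + p`. -/
theorem CS_regularity_le
    {K : Type} [Field K] [Infinite K] {v : ℕ} {n : Fin v → ℕ}
    (I : Ideal (MvPolynomial (MVar v n) K)) (hI : IsCS I) :
    ∀ F : GradedFreeResolution (MVar v n) K ℕ (fun _ => 1) I,
      F.Minimal → ∀ (p : ℕ) (i : F.ι p), F.deg p i ≤ v + p := by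
  intro F hF p i
  by_contra hlt
  exact CSReg.not_Kvan_of_minimal hF p i (CSReg.Kvan_of_isCS hI (by omega))

end
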